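/- Let M be a commutative monoid. Then the semigroup variety generated by M is definable in the lattice Com; that is, there exists a first-order formula Φ(x) with one free variable in the language of the lattice operations ∨ and ∧ such that for every commutative semigroup variety V, the sentence Φ(V) is true in Com if and only if V equals the variety generated by M. -/

import Mathlib

open FirstOrder

/-! ### Words, identities, and commutative semigroup varieties -/

/-- Semigroup words over the countable alphabet `ℕ`. -/
abbrev SGWord : Type := FreeSemigroup ℕ

/-- A semigroup identity `u = v` is a pair of words. -/
abbrev SGId : Type := SGWord × SGWord

/-- The one-letter word consisting of the letter `n`. -/
def ltr (n : ℕ) : SGWord := FreeSemigroup.of n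

/-- `wpow w n` is the word `w^n` (for `n ≥ 1`; by convention `wpow w 0 = w`). -/
def wpow (w : SGWord) : ℕ → SGWord
  | 0 => w
  | 1 => w
  | n + 2 => wpow w (n + 1) * w

/-- The letter `n` occurs in the word `w`. -/
def OccursIn (n : ℕ) (w : SGWord) : Prop := n = w.head ∨ n ∈ w.tail

/-- A semigroup `S` satisfies the identity `i.1 = i.2` if all evaluations of the two
words in `S` coincide. -/
def SGSatisfies (S : Type) [Semigroup S] (i : SGId) : Prop :=
  ∀ f : ℕ → S, FreeSemigroup.lift f i.1 = FreeSemigroup.lift f i.2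

/-- A bundled (nonempty) commutative semigroup. -/
structure ComSG where
  carrier : Type
  [str : CommSemigroup carrier]
  [instNonempty : Nonempty carrier]

attribute [instance] ComSG.str ComSG.instNonempty

/-- The class of commutative semigroups satisfying every identity in `E`. -/
def modelsOf (E : Set SGId) : Set ComSG := {S | ∀ i ∈ E, SGSatisfies S.carrier i}

/-- The set of identities holding in every member of the class `K`. -/
def theoryOfClass (K : Set ComSG) : Set SGId := {i | ∀ S ∈ K, SGSatisfies S.carrier i}

theorem subset_theoryOfClass_modelsOf (E : Set SGId) : E ⊆ theoryOfClass (modelsOf E) :=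
  fun i hi S hS => hS i hi

theorem theoryOfClass_antitone {K K' : Set ComSG} (h : K ⊆ K') :
    theoryOfClass K' ⊆ theoryOfClass K := fun _ hi S hS => hi S (h hS)

theorem modelsOf_antitone {E E' : Set SGId} (h : E ⊆ E') : modelsOf E' ⊆ modelsOf E :=
  fun _ hS i hi => hS i (h hi)

/-- A variety of commutative semigroups, identified with its (equationally closed)
equational theory.  Varieties are ordered by inclusion of the corresponding classes
of semigroups, i.e. by *reverse* inclusion of theories. -/
structure ComVariety where
  theory : Set SGId
  closed : theoryOfClass (modelsOf theory) = theory

theorem ComVariety.ext' {V W : ComVariety} (h : V.theory = W.theory) : V = W := by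
  cases V; cases W; cases h; rfl

instance : PartialOrder ComVariety where
  le V W := W.theory ⊆ V.theory
  le_refl V := subset_rfl
  le_trans U V W h1 h2 := fun i hi => h1 (h2 hi)
  le_antisymm V W h1 h2 := ComVariety.ext' (subset_antisymm h2 h1)

instance : SupSet ComVariety where
  sSup s :=
    { theory := ⋂ V ∈ s, V.theory
      closed := by
        apply subset_antisymm
        · intro i hi
          refine Set.mem_iInter₂.2 fun V hV => ?_
          have h1 : (⋂ V ∈ s, ComVariety.theory V) ⊆ V.theory := Set.biInter_subset_of_mem hV
          have h2 := theoryOfClass_antitone (modelsOf_antitone h1)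
          rw [V.closed] at h2
          exact h2 hi
        · exact subset_theoryOfClass_modelsOf _ }

/-- The lattice **Com** of all commutative semigroup varieties. -/
instance : CompleteLattice ComVariety :=
  completeLatticeOfSup ComVariety fun s => by
    constructor
    · intro V hV i hi
      exact Set.mem_iInter₂.1 hi V hV
    · intro W hW i hi
      exact Set.mem_iInter₂.2 fun V hV => hW hV hi

/-- The variety of commutative semigroups given by the identity system `E`. -/
def comVar (E : Set SGId) : ComVariety where
  theory := theoryOfClass (modelsOf E)
  closed := by
    apply subset_antisymm
    · exact theoryOfClass_antitone fun S hS i hi => hi S hS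
    · exact subset_theoryOfClass_modelsOf _

/-! ### The first-order language of lattices and definability -/

/-- The first-order language of lattices: two binary function symbols (`true` for the
join `∨` and `false` for the meet `∧`) and nothing else. -/
def latticeLang : Language where
  Functions := fun n => match n with | 2 => Bool | _ => Empty
  Relations := fun _ => Empty

instance latticeLangStructure (L : Type*) [Lattice L] : latticeLang.Structure L where
  funMap {n} f x :=
    match n, f with
    | 2, b => bif b then x 0 ⊔ x 1 else x 0 ⊓ x 1
    | 0, f => f.elim
    | 1, f => f.elim
    | (_ + 3), f => f.elim
  RelMap {n} r _ := r.elim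

/-- A subset `A` of a lattice `L` is definable in `L` if there is a first-order formula
`φ(x)` with one free variable in the language of the lattice operations `∨` and `∧`
such that for every `a ∈ L`, `φ(a)` holds in `L` if and only if `a ∈ A`. -/
def LatDefinable (L : Type*) [Lattice L] (A : Set L) : Prop :=
  ∃ φ : latticeLang.Formula (Fin 1), ∀ a : L, (φ.Realize fun _ => a) ↔ a ∈ A

/-! ### Named varieties -/

/-- The commutativity identity `xy = yx`. -/
def commId : SGId := (ltr 0 * ltr 1, ltr 1 * ltr 0)

/-- The pair of identities abbreviated by the symbolic identity `w = 0`, namely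
`wx = w` and `xw = w`, where `x` is the letter `n` (assumed not to occur in `w`). -/
def zeroId (w : SGWord) (n : ℕ) : Set SGId := {(w * ltr n, w), (ltr n * w, w)}

/-- `A n = var{xⁿy = y, xy = yx}`, the variety of Abelian groups of exponent dividing `n`. -/
def Avar (n : ℕ) : ComVariety := comVar {(wpow (ltr 0) n * ltr 1, ltr 1), commId}

/-- `SL = var{x² = x, xy = yx}`, the variety of semilattices. -/
def SLvar : ComVariety := comVar {(wpow (ltr 0) 2, ltr 0), commId}

/-- `ZM = var{xy = 0}` (within **Com**), the variety of null semigroups. -/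
def ZMvar : ComVariety := comVar ({commId} ∪ zeroId (ltr 0 * ltr 1) 2)

/-- `T = var{x = y}`, the trivial variety. -/
def Tvar : ComVariety := comVar {(ltr 0, ltr 1)}

/-- `COM`, the variety of all commutative semigroups. -/
def COMvar : ComVariety := comVar {commId}

/-- `C m = var{xᵐ = xᵐ⁺¹, xy = yx}` (the variety generated by the cyclic monoid
`⟨a ∣ aᵐ = aᵐ⁺¹⟩`), with the convention `C 0 = T`. -/
def Cvar : ℕ → ComVariety
  | 0 => Tvar
  | m + 1 => comVar {(wpow (ltr 0) (m + 1), wpow (ltr 0) (m + 2)), commId}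

/-- `D m = var{xᵐ = 0, xy = yx}`. -/
def Dvar (m : ℕ) : ComVariety := comVar ({commId} ∪ zeroId (wpow (ltr 0) m) 1)

/-- The word `x₁x₂⋯x_k` (in the letters `0, 1, …, k-1`), for `k ≥ 1`. -/
def chainWord : ℕ → SGWord
  | 0 => ltr 0
  | 1 => ltr 0
  | k + 2 => chainWord (k + 1) * ltr (k + 1)

/-- `N k = var{x² = x₁x₂⋯x_k = 0, xy = yx}`. -/
def Nvar (k : ℕ) : ComVariety :=
  comVar ({commId} ∪ zeroId (wpow (ltr 0) 2) 1 ∪ zeroId (chainWord k) k)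

/-- `N_ω = var{x² = 0, xy = yx}`. -/
def Nomegavar : ComVariety := comVar ({commId} ∪ zeroId (wpow (ltr 0) 2) 1)

/-- `N₃ᶜ = var{xyz = 0, xy = yx}`. -/
def N3cvar : ComVariety := comVar ({commId} ∪ zeroId (ltr 0 * ltr 1 * ltr 2) 3)

/-! ### Semantic notions -/

/-- A semigroup `S` belongs to the variety `V` if it satisfies every identity of `V`. -/
def VMem (S : Type) [Semigroup S] (V : ComVariety) : Prop :=
  ∀ i ∈ V.theory, SGSatisfies S i

/-- `spow a n` is the power `aⁿ` in a semigroup (for `n ≥ 1`; by convention `spow a 0 = a`). -/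
def spow {S : Type} [Semigroup S] (a : S) : ℕ → S
  | 0 => a
  | 1 => a
  | n + 2 => spow a (n + 1) * a

/-- A semigroup is a group. -/
def IsGroupSG (S : Type) [Semigroup S] : Prop :=
  ∃ e : S, (∀ a, e * a = a ∧ a * e = a) ∧ ∀ a, ∃ b, a * b = e ∧ b * a = e

/-- A semigroup is periodic: every element generates a finite cyclic subsemigroup. -/
def IsPeriodicSG (S : Type) [Semigroup S] : Prop :=
  ∀ a : S, ∃ i j : ℕ, 1 ≤ i ∧ i < j ∧ spow a i = spow a j

/-- A semigroup is a nil-semigroup: it has a zero element and every element has a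
power equal to zero. -/
def IsNilSG (S : Type) [Semigroup S] : Prop :=
  ∃ z : S, (∀ a, z * a = z ∧ a * z = z) ∧ ∀ a, ∃ n, 1 ≤ n ∧ spow a n = z

/-- A variety all of whose members are groups. -/
def IsGroupVariety (V : ComVariety) : Prop := ∀ S ∈ modelsOf V.theory, IsGroupSG S.carrier

/-- A variety all of whose members are periodic semigroups. -/
def IsPeriodicVariety (V : ComVariety) : Prop := ∀ S ∈ modelsOf V.theory, IsPeriodicSG S.carrier

/-- A nil-variety: a variety all of whose members are nil-semigroups. -/
def IsNilVariety (V : ComVariety) : Prop := ∀ S ∈ modelsOf V.theory, IsNilSG S.carrier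

/-- A combinatorial variety: all groups in it are trivial. -/
def IsCombinatorial (V : ComVariety) : Prop :=
  ∀ S ∈ modelsOf V.theory, IsGroupSG S.carrier → ∀ a b : S.carrier, a = b

/-- `K` is the variety generated by the semigroup `M` (with explicit semigroup
structure `inst`): the smallest variety containing `M`. -/
def GeneratedBy (M : Type) (inst : Semigroup M) (K : ComVariety) : Prop :=
  IsLeast {W : ComVariety | ∀ i ∈ W.theory, @SGSatisfies M inst i} K

/-- A neutral element of a lattice. -/
def IsNeutralElt {α : Type*} [Lattice α] (x : α) : Prop :=
  ∀ y z, (x ⊔ y) ⊓ (y ⊔ z) ⊓ (z ⊔ x) = (x ⊓ y) ⊔ (y ⊓ z) ⊔ (z ⊓ x)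

/-- A chain variety: a variety whose lattice of subvarieties is a chain. -/
def IsChainVariety (V : ComVariety) : Prop :=
  ∀ W₁ W₂ : ComVariety, W₁ ≤ V → W₂ ≤ V → W₁ ≤ W₂ ∨ W₂ ≤ W₁

/-- A variety is 0-reduced in **Com** if it is given within `COM` by 0-reduced
identities (identities of the form `w = 0`) only. -/
def IsZeroReduced (V : ComVariety) : Prop :=
  ∃ P : Set (SGWord × ℕ), (∀ p ∈ P, ¬ OccursIn p.2 p.1) ∧
    V = comVar (⋃ p ∈ P, zeroId p.1 p.2)

/-- `ZR V`: the least variety 0-reduced in **Com** that contains `V`. -/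
def ZRv (V : ComVariety) : ComVariety := sInf {W : ComVariety | IsZeroReduced W ∧ V ≤ W}

/-! ### First-order definable predicates on a lattice -/

section Definability

variable {L : Type*} [Lattice L]

/-- `t` is the function of a tuple computed by some lattice term. -/
def IsLatTerm (n : ℕ) (t : (Fin n → L) → L) : Prop :=
  ∃ τ : latticeLang.Term (Empty ⊕ Fin n), ∀ v, τ.realize (Sum.elim Empty.elim v) = t v

/-- `P` is the predicate on tuples expressed by some first-order formula. -/
def IsLatDef (n : ℕ) (P : (Fin n → L) → Prop) : Prop :=
  ∃ φ : latticeLang.BoundedFormula Empty n, ∀ v, φ.Realize Empty.elim v ↔ P v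

theorem IsLatTerm.last (n : ℕ) : IsLatTerm (n + 1) fun v : Fin (n + 1) → L => v (Fin.last n) :=
  ⟨Language.Term.var (Sum.inr (Fin.last n)), fun _ => rfl⟩

theorem IsLatTerm.init {n : ℕ} {t : (Fin n → L) → L} (ht : IsLatTerm n t) :
    IsLatTerm (n + 1) fun v : Fin (n + 1) → L => t (Fin.init v) := by
  obtain ⟨τ, hτ⟩ := ht
  refine ⟨τ.relabel (Sum.map id Fin.castSucc), fun v => ?_⟩
  rw [Language.Term.realize_relabel]
  refine Eq.trans ?_ (hτ _)
  congr 1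
  ext (x | x)
  · exact x.elim
  · rfl

theorem IsLatTerm.sup {n : ℕ} {t s : (Fin n → L) → L} (ht : IsLatTerm n t)
    (hs : IsLatTerm n s) : IsLatTerm n fun v => t v ⊔ s v := by
  obtain ⟨τ, hτ⟩ := ht
  obtain ⟨σ, hσ⟩ := hs
  refine ⟨@Language.Term.func latticeLang (Empty ⊕ Fin n) 2 true ![τ, σ], fun v => ?_⟩
  exact congrArg₂ (· ⊔ ·) (hτ v) (hσ v)

theorem IsLatDef.eq {n : ℕ} {t s : (Fin n → L) → L} (ht : IsLatTerm n t)
    (hs : IsLatTerm n s) : IsLatDef n fun v => t v = s v := by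
  obtain ⟨τ, hτ⟩ := ht
  obtain ⟨σ, hσ⟩ := hs
  exact ⟨τ.bdEqual σ, fun v => by rw [Language.BoundedFormula.realize_bdEqual, hτ, hσ]⟩

theorem IsLatDef.congr {n : ℕ} {P Q : (Fin n → L) → Prop} (hP : IsLatDef n P)
    (h : ∀ v, P v ↔ Q v) : IsLatDef n Q := by
  obtain ⟨φ, hφ⟩ := hP
  exact ⟨φ, fun v => (hφ v).trans (h v)⟩

theorem IsLatDef.le {n : ℕ} {t s : (Fin n → L) → L} (ht : IsLatTerm n t)
    (hs : IsLatTerm n s) : IsLatDef n fun v => t v ≤ s v :=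
  (IsLatDef.eq (ht.sup hs) hs).congr fun _ => sup_eq_right

theorem IsLatDef.not {n : ℕ} {P : (Fin n → L) → Prop} (hP : IsLatDef n P) :
    IsLatDef n fun v => ¬ P v := by
  obtain ⟨φ, hφ⟩ := hP
  exact ⟨φ.not, fun v => by rw [Language.BoundedFormula.realize_not, hφ]⟩

theorem IsLatDef.imp {n : ℕ} {P Q : (Fin n → L) → Prop} (hP : IsLatDef n P)
    (hQ : IsLatDef n Q) : IsLatDef n fun v => P v → Q v := by
  obtain ⟨φ, hφ⟩ := hP
  obtain ⟨ψ, hψ⟩ := hQ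
  exact ⟨φ.imp ψ, fun v => by rw [Language.BoundedFormula.realize_imp, hφ, hψ]⟩

theorem IsLatDef.and {n : ℕ} {P Q : (Fin n → L) → Prop} (hP : IsLatDef n P)
    (hQ : IsLatDef n Q) : IsLatDef n fun v => P v ∧ Q v := by
  obtain ⟨φ, hφ⟩ := hP
  obtain ⟨ψ, hψ⟩ := hQ
  exact ⟨φ ⊓ ψ, fun v => by rw [Language.BoundedFormula.realize_inf, hφ, hψ]⟩

theorem IsLatDef.all {n : ℕ} {P : (Fin n → L) → L → Prop}
    (hP : IsLatDef (n + 1) fun v => P (Fin.init v) (v (Fin.last n))) :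
    IsLatDef n fun v => ∀ a, P v a := by
  obtain ⟨φ, hφ⟩ := hP
  refine ⟨φ.all, fun v => ?_⟩
  rw [Language.BoundedFormula.realize_all]
  exact forall_congr' fun a => by rw [hφ]; simp

theorem IsLatDef.ex {n : ℕ} {P : (Fin n → L) → L → Prop}
    (hP : IsLatDef (n + 1) fun v => P (Fin.init v) (v (Fin.last n))) :
    IsLatDef n fun v => ∃ a, P v a :=
  (IsLatDef.all (P := fun v a => ¬ P v a) hP.not).not.congr fun v => by simp

theorem IsLatDef.forall_lt {n : ℕ} {P : ℕ → (Fin n → L) → Prop} :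
    ∀ k : ℕ, (∀ j < k, IsLatDef n (P j)) → IsLatDef n fun v => ∀ j < k, P j v
  | 0, _ => ⟨⊤, fun v => by simp⟩
  | k + 1, h => by
    refine ((IsLatDef.forall_lt k fun j hj => h j (by omega)).and (h k (by omega))).congr
      fun v => ⟨fun ⟨h1, h2⟩ j hj => ?_, fun H => ⟨fun j hj => H j (by omega), H k (by omega)⟩⟩
    rcases Nat.lt_succ_iff_lt_or_eq.1 hj with h | rfl
    exacts [h1 j h, h2]

/-- A unary predicate which is first-order definable, uniformly in the ambient context. -/
def IsPredDef (P : L → Prop) : Prop := ∀ n t, IsLatTerm n t → IsLatDef n fun v => P (t v)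

/-- A binary predicate which is first-order definable, uniformly in the ambient context. -/
def IsRelDef (P : L → L → Prop) : Prop :=
  ∀ n s t, IsLatTerm n s → IsLatTerm n t → IsLatDef n fun v => P (s v) (t v)

theorem IsPredDef.congr {P Q : L → Prop} (hP : IsPredDef P) (h : ∀ a, P a ↔ Q a) : IsPredDef Q :=
  fun n t ht => (hP n t ht).congr fun _ => h _

theorem IsPredDef.latDefinable {a : L} (h : IsPredDef (· = a)) : LatDefinable L {x | x = a} := by
  obtain ⟨φ, hφ⟩ := h 1 _ (IsLatTerm.last 0)
  refine ⟨φ.toFormula.relabel (Sum.elim Empty.elim id), fun x => ?_⟩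
  rw [Language.Formula.realize_relabel, Language.BoundedFormula.realize_toFormula]
  have := hφ fun _ => x
  simp only [Set.mem_ofPred_eq] at this ⊢
  rw [← this]
  apply iff_of_eq
  congr 1
  ext y
  exact y.elim

theorem isPredDef_eq_sup {a b : L} (ha : IsPredDef (· = a)) (hb : IsPredDef (· = b)) :
    IsPredDef (· = a ⊔ b) := by
  intro n t ht
  have : IsLatDef n fun v => ∃ x, x = a ∧ ∃ y, y = b ∧ t v = x ⊔ y :=
    .ex (.and (ha _ _ (.last _)) (.ex (.and (hb _ _ (.last _))
      (.eq ht.init.init (.sup (.init (.last _)) (.last _))))))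
  exact this.congr fun v => by simp

theorem IsPredDef.ge {a : L} (ha : IsPredDef (· = a)) : IsPredDef (a ≤ ·) := by
  intro n t ht
  have : IsLatDef n fun v => ∃ x, x = a ∧ x ≤ t v :=
    .ex (.and (ha _ _ (.last _)) (.le (.last _) ht.init))
  exact this.congr fun v => by simp

theorem isPredDef_eq_top [OrderTop L] : IsPredDef fun a : L => a = ⊤ := by
  intro n t ht
  have : IsLatDef n fun v => ∀ x, x ≤ t v := .all (.le (.last _) ht.init)
  exact this.congr fun v => ⟨fun h => top_le_iff.1 (h _), fun h => by simp [h]⟩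

theorem isPredDef_eq_bot [OrderBot L] : IsPredDef fun a : L => a = ⊥ := by
  intro n t ht
  have : IsLatDef n fun v => ∀ x, t v ≤ x := .all (.le ht.init (.last _))
  exact this.congr fun v => ⟨fun h => le_bot_iff.1 (h _), fun h => by simp [h]⟩

end Definability

/-! ### Multisets of letters and fully invariant congruences -/

/-- The multiset of letters of a word. -/
def letters (w : SGWord) : Multiset ℕ := w.head ::ₘ (w.tail : Multiset ℕ)

theorem letters_of (i : ℕ) : letters (FreeSemigroup.of i) = {i} := rfl

theorem letters_mul (u v : SGWord) : letters (u * v) = letters u + letters v := by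
  simp only [letters, FreeSemigroup.head_mul, FreeSemigroup.tail_mul, ← Multiset.coe_add,
    ← Multiset.cons_coe, Multiset.cons_add]

theorem letters_ne_zero (w : SGWord) : letters w ≠ 0 := Multiset.cons_ne_zero

theorem exists_letters {s : Multiset ℕ} (hs : s ≠ 0) : ∃ w, letters w = s := by
  obtain ⟨i, hi⟩ := Multiset.exists_mem_of_ne_zero hs
  obtain ⟨t, rfl⟩ := Multiset.exists_cons_of_mem hi
  exact ⟨⟨i, t.toList⟩, by simp [letters]⟩

theorem bind_singleton_self (s : Multiset ℕ) : (s.bind fun i => {i}) = s :=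
  (Multiset.bind_singleton s id).trans (Multiset.map_id s)

/-- A fully invariant congruence on the free commutative semigroup, whose elements are represented
by the nonempty multisets of letters; the empty multiset is related to itself only. -/
structure FIC where
  /-- The underlying relation. -/
  r : Multiset ℕ → Multiset ℕ → Prop
  refl : ∀ s, r s s
  symm : ∀ {s t}, r s t → r t s
  trans : ∀ {s t u}, r s t → r t u → r s u
  add : ∀ {s t} u, r s t → r (s + u) (t + u)
  bind : ∀ {s t} f, (∀ i, f i ≠ 0) → r s t → r (s.bind f) (t.bind f)
  zero : ∀ {t}, r 0 t → t = 0

/-- The value of a multiset of letters in a commutative semigroup with an adjoined identity. -/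
def evalIn {S : Type} [CommSemigroup S] (f : ℕ → S) (s : Multiset ℕ) : WithOne S :=
  (s.map fun i => (f i : WithOne S)).prod

theorem coe_lift_eq_evalIn {S : Type} [CommSemigroup S] (f : ℕ → S) (w : SGWord) :
    ((FreeSemigroup.lift f w : S) : WithOne S) = evalIn f (letters w) := by
  induction w using FreeSemigroup.recOnMul with
  | ih1 i => simp [evalIn, letters_of]
  | ih2 i w h1 h2 =>
    rw [map_mul, WithOne.coe_mul, h1, h2, letters_mul, evalIn, evalIn, evalIn, Multiset.map_add,
      Multiset.prod_add]

theorem exists_coe_eq_evalIn {S : Type} [CommSemigroup S] (f : ℕ → S) {s : Multiset ℕ}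
    (hs : s ≠ 0) : ∃ a : S, (a : WithOne S) = evalIn f s := by
  obtain ⟨w, rfl⟩ := exists_letters hs
  exact ⟨_, coe_lift_eq_evalIn f w⟩

theorem evalIn_bind {S : Type} [CommSemigroup S] (f : ℕ → S) (g : ℕ → Multiset ℕ) (f' : ℕ → S)
    (h : ∀ i, (f' i : WithOne S) = evalIn f (g i)) (s : Multiset ℕ) :
    evalIn f (s.bind g) = evalIn f' s := by
  simp only [evalIn, Multiset.map_bind, Multiset.prod_bind]
  congr 1
  exact Multiset.map_congr rfl fun i _ => (h i).symm

theorem bind_ne_zero {s : Multiset ℕ} (hs : s ≠ 0) {f : ℕ → Multiset ℕ} (hf : ∀ i, f i ≠ 0) :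
    s.bind f ≠ 0 := by
  obtain ⟨i, hi⟩ := Multiset.exists_mem_of_ne_zero hs
  obtain ⟨j, hj⟩ := Multiset.exists_mem_of_ne_zero (hf i)
  exact fun h => Multiset.notMem_zero j (h ▸ Multiset.mem_bind.2 ⟨i, hi, hj⟩)

theorem bind_eq_zero {s : Multiset ℕ} {f : ℕ → Multiset ℕ} (hf : ∀ i, f i ≠ 0) :
    s.bind f = 0 ↔ s = 0 :=
  ⟨fun h => by_contra fun h' => bind_ne_zero h' hf h, fun h => by simp [h]⟩

/-- The fully invariant congruence of a variety. -/
def ComVariety.fic (V : ComVariety) : FIC where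
  r s t := (s = 0 ↔ t = 0) ∧ ∀ S ∈ modelsOf V.theory, ∀ f : ℕ → S.carrier, evalIn f s = evalIn f t
  refl s := ⟨Iff.rfl, fun _ _ _ => rfl⟩
  symm h := ⟨h.1.symm, fun S hS f => (h.2 S hS f).symm⟩
  trans h h' := ⟨h.1.trans h'.1, fun S hS f => (h.2 S hS f).trans (h'.2 S hS f)⟩
  add u h := by
    refine ⟨by simp [h.1], fun S hS f => ?_⟩
    have := h.2 S hS f
    simp only [evalIn, Multiset.map_add, Multiset.prod_add] at this ⊢
    rw [this]
  bind g hg h := by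
    refine ⟨by rw [bind_eq_zero hg, bind_eq_zero hg, h.1], fun S hS f => ?_⟩
    choose f' hf' using fun i => exists_coe_eq_evalIn f (hg i)
    rw [evalIn_bind f g f' hf', evalIn_bind f g f' hf', h.2 S hS f']
  zero h := h.1.1 rfl

/-- `V.r s t` says that the variety `V` satisfies the identity `s = t`. -/
abbrev ComVariety.r (V : ComVariety) : Multiset ℕ → Multiset ℕ → Prop := V.fic.r

theorem ComVariety.r_letters (V : ComVariety) (u v : SGWord) :
    V.r (letters u) (letters v) ↔ (u, v) ∈ V.theory := by
  refine ⟨fun h => ?_, fun h => ⟨by simp [letters_ne_zero], fun S hS f => ?_⟩⟩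
  · rw [← V.closed]
    intro S hS f
    have := h.2 S hS f
    rwa [← coe_lift_eq_evalIn, ← coe_lift_eq_evalIn, WithOne.coe_inj] at this
  · rw [← coe_lift_eq_evalIn, ← coe_lift_eq_evalIn]
    exact congrArg _ (hS _ h f)

theorem ComVariety.le_iff {V W : ComVariety} : V ≤ W ↔ ∀ s t, W.r s t → V.r s t := by
  constructor
  · intro h s t hst
    by_cases hs : s = 0
    · subst hs
      rw [W.fic.zero hst]
      exact V.fic.refl _
    · obtain ⟨u, rfl⟩ := exists_letters hs
      obtain ⟨v, rfl⟩ := exists_letters (mt hst.1.2 hs)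
      exact (V.r_letters u v).2 (h ((W.r_letters u v).1 hst))
  · intro h i hi
    exact (V.r_letters _ _).1 (h _ _ ((W.r_letters i.1 i.2).2 hi))

namespace FIC

variable (R : FIC)

/-- The congruence restricted to nonempty multisets, as a setoid. -/
def setoid : Setoid {s : Multiset ℕ // s ≠ 0} where
  r s t := R.r s t
  iseqv := ⟨fun _ => R.refl _, R.symm, R.trans⟩

theorem add_congr {s t s' t' : Multiset ℕ} (h : R.r s t) (h' : R.r s' t') :
    R.r (s + s') (t + t') := by
  refine R.trans (R.add s' h) ?_
  rw [add_comm t, add_comm t]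
  exact R.add t h'

theorem add_left {s t : Multiset ℕ} (u : Multiset ℕ) (h : R.r s t) : R.r (u + s) (u + t) :=
  R.add_congr (R.refl _) h

/-- The relatively free commutative semigroup of the congruence. -/
instance freeComSemigroup : CommSemigroup (Quotient R.setoid) where
  mul := Quotient.map₂ (fun s t => ⟨s.1 + t.1, by simp [s.2]⟩) fun _ _ h _ _ h' => R.add_congr h h'
  mul_assoc := by
    rintro ⟨a⟩ ⟨b⟩ ⟨c⟩
    exact congrArg (Quotient.mk _) (Subtype.ext (add_assoc _ _ _))
  mul_comm := by
    rintro ⟨a⟩ ⟨b⟩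
    exact congrArg (Quotient.mk _) (Subtype.ext (add_comm _ _))

theorem lift_mk (g : ℕ → {s : Multiset ℕ // s ≠ 0}) (w : SGWord) :
    FreeSemigroup.lift (fun i => Quotient.mk R.setoid (g i)) w =
      Quotient.mk R.setoid
        ⟨(letters w).bind fun i => g i, bind_ne_zero (letters_ne_zero w) fun i => (g i).2⟩ := by
  induction w using FreeSemigroup.recOnMul with
  | ih1 i => simp [letters_of]
  | ih2 i w h1 h2 =>
    rw [map_mul, h1, h2]
    refine congrArg (Quotient.mk _) (Subtype.ext ?_)
    simp [letters_mul]

/-- The variety of a fully invariant congruence. -/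
def toVariety : ComVariety where
  theory := {i | R.r (letters i.1) (letters i.2)}
  closed := by
    refine subset_antisymm ?_ (subset_theoryOfClass_modelsOf _)
    intro i hi
    let F : ComSG :=
      { carrier := Quotient R.setoid
        instNonempty := ⟨Quotient.mk _ ⟨{0}, by simp⟩⟩ }
    have hF : F ∈ modelsOf {i | R.r (letters i.1) (letters i.2)} := by
      intro j hj f
      have hf : f = fun i => Quotient.mk R.setoid (f i).out := by
        funext i
        exact (Quotient.out_eq _).symm
      rw [hf]
      refine (R.lift_mk _ _).trans (Eq.trans ?_ (R.lift_mk _ _).symm)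
      exact Quotient.sound (R.bind _ (fun i => (Quotient.out (s := R.setoid) (f i)).2) hj)
    have h := hi F hF fun i => Quotient.mk R.setoid ⟨{i}, by simp⟩
    have h' : R.r _ _ := Quotient.exact ((R.lift_mk _ _).symm.trans (h.trans (R.lift_mk _ _)))
    simp only [bind_singleton_self] at h'
    exact h'

theorem toVariety_r {s t : Multiset ℕ} : R.toVariety.r s t ↔ R.r s t := by
  by_cases hs : s = 0
  · subst hs
    refine ⟨fun h => ?_, fun h => ?_⟩
    · rw [R.toVariety.fic.zero h]
      exact R.refl _
    · rw [R.zero h]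
      exact R.toVariety.fic.refl _
  by_cases ht : t = 0
  · subst ht
    exact ⟨fun h => absurd (R.toVariety.fic.zero (R.toVariety.fic.symm h)) hs,
      fun h => absurd (R.zero (R.symm h)) hs⟩
  obtain ⟨u, rfl⟩ := exists_letters hs
  obtain ⟨v, rfl⟩ := exists_letters ht
  exact R.toVariety.r_letters u v

/-- The fully invariant congruence generated by a relation. -/
inductive GenRel (E : Multiset ℕ → Multiset ℕ → Prop) : Multiset ℕ → Multiset ℕ → Prop
  | step {p q : Multiset ℕ} (a : Multiset ℕ) (f : ℕ → Multiset ℕ) (h : E p q) (hp : p ≠ 0)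
      (hq : q ≠ 0) (hf : ∀ i, f i ≠ 0) : GenRel E (a + p.bind f) (a + q.bind f)
  | refl (s : Multiset ℕ) : GenRel E s s
  | symm {s t : Multiset ℕ} : GenRel E s t → GenRel E t s
  | trans {s t u : Multiset ℕ} : GenRel E s t → GenRel E t u → GenRel E s u

theorem GenRel.eq_zero_iff {E : Multiset ℕ → Multiset ℕ → Prop} {s t : Multiset ℕ}
    (h : GenRel E s t) : s = 0 ↔ t = 0 := by
  induction h with
  | step a f h hp hq hf => simp [bind_eq_zero hf, hp, hq]
  | refl => rfl
  | symm _ ih => exact ih.symm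
  | trans _ _ ih1 ih2 => exact ih1.trans ih2

/-- The fully invariant congruence generated by a relation. -/
def gen (E : Multiset ℕ → Multiset ℕ → Prop) : FIC where
  r := GenRel E
  refl := .refl
  symm := .symm
  trans := .trans
  add u h := by
    induction h with
    | step a f h hp hq hf =>
      rw [add_right_comm, add_right_comm a (Multiset.bind _ f) u]
      exact .step _ f h hp hq hf
    | refl s => exact .refl _
    | symm _ ih => exact ih.symm
    | trans _ _ ih1 ih2 => exact ih1.trans ih2
  bind g hg h := by
    induction h with
    | step a f h hp hq hf =>
      rw [Multiset.add_bind, Multiset.add_bind, Multiset.bind_assoc, Multiset.bind_assoc]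
      exact .step _ _ h hp hq fun i => bind_ne_zero (hf i) hg
    | refl s => exact .refl _
    | symm _ ih => exact ih.symm
    | trans _ _ ih1 ih2 => exact ih1.trans ih2
  zero h := h.eq_zero_iff.1 rfl

theorem gen_of {E : Multiset ℕ → Multiset ℕ → Prop} {p q : Multiset ℕ} (h : E p q) (hp : p ≠ 0)
    (hq : q ≠ 0) : (gen E).r p q := by
  simpa only [zero_add, bind_singleton_self] using
    show (gen E).r _ _ from .step 0 (fun i => {i}) h hp hq fun i => by simp

theorem gen_le {E : Multiset ℕ → Multiset ℕ → Prop} (h : ∀ p q, E p q → R.r p q)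
    {s t : Multiset ℕ} (hst : (gen E).r s t) : R.r s t := by
  induction hst with
  | step a f h' hp hq hf => exact R.add_left _ (R.bind f hf (h _ _ h'))
  | refl s => exact R.refl _
  | symm _ ih => exact R.symm ih
  | trans _ _ ih1 ih2 => exact R.trans ih1 ih2

/-- The congruence given by `s = t = 0` for all `s`, `t` in a set of multisets. -/
def ofIdeal (J : Multiset ℕ → Prop) (h0 : ¬ J 0) (hadd : ∀ s u, J s → J (s + u))
    (hbind : ∀ s f, (∀ i, f i ≠ 0) → J s → J (s.bind f)) : FIC where
  r s t := s = t ∨ J s ∧ J t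
  refl s := .inl rfl
  symm := by
    rintro s t (rfl | h)
    exacts [.inl rfl, .inr h.symm]
  trans := by
    rintro s t u (rfl | h) (rfl | h')
    exacts [.inl rfl, .inr h', .inr h, .inr ⟨h.1, h'.2⟩]
  add := by
    rintro s t u (rfl | h)
    exacts [.inl rfl, .inr ⟨hadd _ _ h.1, hadd _ _ h.2⟩]
  bind := by
    rintro s t f hf (rfl | h)
    exacts [.inl rfl, .inr ⟨hbind _ _ hf h.1, hbind _ _ hf h.2⟩]
  zero := by
    rintro t (h | h)
    exacts [h.symm, absurd h.1 h0]

theorem count_bind_eq (s : Multiset ℕ) (f : ℕ → Multiset ℕ) (i : ℕ) :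
    (s.bind f).count i = (s.map fun j => (f j).count i).sum := Multiset.count_bind

/-- The congruence comparing multiplicities of letters by an additive congruence of `ℕ`. -/
def ofCounts (c : AddCon ℕ) : FIC where
  r s t := (s = 0 ↔ t = 0) ∧ ∀ i, c (s.count i) (t.count i)
  refl s := ⟨Iff.rfl, fun i => c.refl _⟩
  symm h := ⟨h.1.symm, fun i => c.symm (h.2 i)⟩
  trans h h' := ⟨h.1.trans h'.1, fun i => c.trans (h.2 i) (h'.2 i)⟩
  add u h := ⟨by simp [h.1], fun i => by
    rw [Multiset.count_add, Multiset.count_add]; exact c.add (h.2 i) (c.refl _)⟩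
  bind {s t} f hf h := by
    refine ⟨by rw [bind_eq_zero hf, bind_eq_zero hf, h.1], fun i => ?_⟩
    have hmul : ∀ {a b : ℕ} (k : ℕ), c a b → c (a * k) (b * k) := by
      intro a b k hab
      induction k with
      | zero => exact c.refl _
      | succ k ih => exact c.add ih hab
    have key : ∀ u : Multiset ℕ, u.toFinset ⊆ s.toFinset ∪ t.toFinset →
        (u.bind f).count i =
          ∑ j ∈ s.toFinset ∪ t.toFinset, u.count j * (f j).count i := by
      intro u hu
      rw [count_bind_eq, Finset.sum_multiset_map_count]
      simp only [smul_eq_mul]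
      exact Finset.sum_subset hu fun j _ hj => by
        rw [Multiset.count_eq_zero_of_notMem (by simpa using hj), zero_mul]
    rw [key s Finset.subset_union_left, key t Finset.subset_union_right]
    induction s.toFinset ∪ t.toFinset using Finset.induction_on with
    | empty => exact c.refl _
    | insert j F hj ih =>
      rw [Finset.sum_insert hj, Finset.sum_insert hj]
      exact c.add (hmul _ (h.2 j)) ih
  zero h := h.1.1 rfl

/-- The intersection of two fully invariant congruences. -/
def inter (R R' : FIC) : FIC where
  r s t := R.r s t ∧ R'.r s t
  refl s := ⟨R.refl s, R'.refl s⟩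
  symm h := ⟨R.symm h.1, R'.symm h.2⟩
  trans h h' := ⟨R.trans h.1 h'.1, R'.trans h.2 h'.2⟩
  add u h := ⟨R.add u h.1, R'.add u h.2⟩
  bind f hf h := ⟨R.bind f hf h.1, R'.bind f hf h.2⟩
  zero h := R.zero h.1

end FIC

theorem ComVariety.sup_r {V W : ComVariety} {s t : Multiset ℕ} :
    (V ⊔ W).r s t ↔ V.r s t ∧ W.r s t := by
  constructor
  · intro h
    exact ⟨ComVariety.le_iff.1 le_sup_left _ _ h, ComVariety.le_iff.1 le_sup_right _ _ h⟩
  · intro h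
    have : V ⊔ W ≤ (FIC.inter V.fic W.fic).toVariety :=
      sup_le (ComVariety.le_iff.2 fun s t h => ((FIC.toVariety_r _).1 h).1)
        (ComVariety.le_iff.2 fun s t h => ((FIC.toVariety_r _).1 h).2)
    exact ComVariety.le_iff.1 this _ _ ((FIC.toVariety_r _).2 h)

/-! ### Substitutions -/

theorem nsmul_bind (n : ℕ) (s : Multiset ℕ) (f : ℕ → Multiset ℕ) :
    (n • s).bind f = n • s.bind f := by
  induction n with
  | zero => simp
  | succ n ih => rw [add_nsmul, add_nsmul, Multiset.add_bind, ih, one_nsmul, one_nsmul]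

theorem bind_const_eq (s p : Multiset ℕ) : (s.bind fun _ => p) = s.card • p := by
  induction s using Multiset.induction_on with
  | empty => simp
  | cons a s ih => rw [Multiset.cons_bind, ih, Multiset.card_cons, succ_nsmul']

theorem bind_ite_eq (s p q : Multiset ℕ) (i : ℕ) :
    (s.bind fun j => if j = i then p else q) = s.count i • p + (s.card - s.count i) • q := by
  induction s using Multiset.induction_on with
  | empty => simp
  | cons a s ih =>
    have := Multiset.count_le_card i s
    rw [Multiset.cons_bind, ih, Multiset.card_cons]
    by_cases h : a = i
    · subst h
      rw [if_pos rfl, Multiset.count_cons_self, Nat.add_sub_add_right, succ_nsmul', add_assoc]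
    · rw [if_neg h, Multiset.count_cons_of_ne (Ne.symm h), Nat.succ_sub this, succ_nsmul',
        add_left_comm]

theorem bind_update_eq {s : Multiset ℕ} {i : ℕ} (hi : i ∉ s) (f : ℕ → Multiset ℕ)
    (p : Multiset ℕ) : s.bind (Function.update f i p) = s.bind f :=
  Multiset.bind_congr fun j hj => Function.update_of_ne (ne_of_mem_of_not_mem hj hi) _ _

theorem nsmul_singleton_le_iff {m i : ℕ} {s : Multiset ℕ} : m • {i} ≤ s ↔ m ≤ s.count i := by
  rw [Multiset.nsmul_singleton, Multiset.le_count_iff_replicate_le]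

theorem ite_ne_zero {p q : Multiset ℕ} (hp : p ≠ 0) (hq : q ≠ 0) (c : ℕ → Prop) [DecidablePred c]
    (j : ℕ) : (if c j then p else q) ≠ 0 := by
  split_ifs <;> assumption

theorem nsmul_singleton_ne_zero {n : ℕ} (hn : n ≠ 0) (i : ℕ) : n • ({i} : Multiset ℕ) ≠ 0 := by
  simp [hn]

theorem card_le_card_bind (s : Multiset ℕ) {f : ℕ → Multiset ℕ} (hf : ∀ i, f i ≠ 0) :
    s.card ≤ (s.bind f).card := by
  rw [Multiset.card_bind]
  have := Multiset.card_nsmul_le_sum (s := s.map (Multiset.card ∘ f)) (a := 1) (by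
    intro x hx
    obtain ⟨i, -, rfl⟩ := Multiset.mem_map.1 hx
    exact Multiset.card_pos.2 (hf i))
  simpa using this

theorem exists_notMem (s : Multiset ℕ) : ∃ i, i ∉ s := by
  obtain ⟨i, hi⟩ := Infinite.exists_notMem_finset s.toFinset
  exact ⟨i, by simpa using hi⟩

namespace ComVariety

variable {V W : ComVariety} {s t u : Multiset ℕ}

theorem r_nsmul (n : ℕ) (h : V.r s t) : V.r (n • s) (n • t) := by
  induction n with
  | zero => simpa using V.fic.refl 0
  | succ n ih => rw [succ_nsmul, succ_nsmul]; exact V.fic.add_congr ih h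

/-- Adding a fixed multiset that is absorbed once is absorbed any number of times. -/
theorem r_add_nsmul (h : V.r s (s + t)) (n : ℕ) : V.r s (s + n • t) := by
  induction n with
  | zero => simpa using V.fic.refl s
  | succ n ih =>
    rw [succ_nsmul', ← add_assoc]
    exact V.fic.trans ih (V.fic.add _ h)

theorem r_pow_bind {a b : ℕ} (h : V.r (a • {0}) (b • {0})) (hs : s ≠ 0) :
    V.r (a • s) (b • s) := by
  have := V.fic.bind (fun _ => s) (fun _ => hs) h
  simpa [nsmul_bind] using this

theorem eq_top_iff : V = ⊤ ↔ ∀ s t, V.r s t → s = t := by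
  let E : FIC := FIC.ofIdeal (fun _ => False) id (fun _ _ => id) fun _ _ _ => id
  constructor
  · rintro rfl s t h
    have := le_iff.1 (le_top : E.toVariety ≤ ⊤) _ _ h
    rw [E.toVariety_r] at this
    exact this.resolve_right fun h => h.1
  · intro h
    refine top_le_iff.1 (le_iff.2 fun s t hst => ?_)
    rw [h s t hst]
    exact FIC.refl _ _

theorem eq_bot_of_r (h : V.r {0} {1}) : V = ⊥ := by
  have key : ∀ s t, s ≠ 0 → t ≠ 0 → V.r s t := by
    intro s t hs ht
    have := V.fic.bind (fun j => if j = 0 then s else t) (ite_ne_zero hs ht _) h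
    simpa using this
  refine le_bot_iff.1 (le_iff.2 fun s t hst => ?_)
  by_cases hs : s = 0
  · subst hs
    rw [FIC.zero _ hst]
    exact V.fic.refl _
  · exact key s t hs (mt hst.1.2 hs)

theorem bot_r (hs : s ≠ 0) (ht : t ≠ 0) : (⊥ : ComVariety).r s t := by
  let E : FIC := FIC.ofIdeal (· ≠ 0) (by simp) (fun s u h => by simp [h])
    fun s f hf h => bind_ne_zero h hf
  exact le_iff.1 (bot_le : ⊥ ≤ E.toVariety) _ _ (E.toVariety_r.2 (.inr ⟨hs, ht⟩))

theorem not_le_iff : ¬ V ≤ W ↔ ∃ s t, W.r s t ∧ ¬ V.r s t := by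
  simp [le_iff]

theorem ne_zero_of_r_of_ne (h : V.r s t) (hst : s ≠ t) : s ≠ 0 := by
  rintro rfl
  exact hst (V.fic.zero h).symm

/-! ### Adjoining an identity -/

/-- The subvariety of `V` given by one more identity. -/
def adj (V : ComVariety) (p q : Multiset ℕ) : ComVariety :=
  (FIC.gen fun s t => V.r s t ∨ s = p ∧ t = q).toVariety

variable {p q : Multiset ℕ}

theorem adj_le : V.adj p q ≤ V := by
  refine le_iff.2 fun s t h => FIC.toVariety_r _ |>.2 ?_
  by_cases hs : s = 0
  · subst hs
    rw [V.fic.zero h]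
    exact FIC.refl _ _
  · exact FIC.gen_of (.inl h) hs (mt h.1.2 hs)

theorem adj_r (hp : p ≠ 0) (hq : q ≠ 0) : (V.adj p q).r p q :=
  FIC.toVariety_r _ |>.2 (FIC.gen_of (.inr ⟨rfl, rfl⟩) hp hq)

theorem le_adj (h : W ≤ V) (h' : W.r p q) : W ≤ V.adj p q := by
  refine le_iff.2 fun s t hst => ?_
  refine FIC.gen_le W.fic ?_ ((FIC.toVariety_r _).1 hst)
  rintro s t (hst | ⟨rfl, rfl⟩)
  exacts [le_iff.1 h _ _ hst, h']

theorem adj_inv {P : Multiset ℕ → Prop} (hV : ∀ s t, V.r s t → P s → P t)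
    (hpq : ∀ a f, (∀ i, f i ≠ 0) → (P (a + p.bind f) ↔ P (a + q.bind f)))
    (h : (V.adj p q).r s t) : P s ↔ P t := by
  have h' : FIC.GenRel _ s t := (FIC.toVariety_r _).1 h
  clear h
  induction h' with
  | step a f hst _ _ hf =>
    rcases hst with h | ⟨rfl, rfl⟩
    · have := V.fic.add_left a (V.fic.bind f hf h)
      exact ⟨hV _ _ this, hV _ _ (V.fic.symm this)⟩
    · exact hpq a f hf
  | refl => rfl
  | symm _ ih => exact ih.symm
  | trans _ _ ih1 ih2 => exact ih1.trans ih2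

/-! ### Zero identities -/

/-- `V` satisfies the identity `s = 0`. -/
def IsZero (V : ComVariety) (s : Multiset ℕ) : Prop := ∀ a, V.r s (s + a)

theorem IsZero.of_r (h : V.IsZero s) (hst : V.r s t) : V.IsZero t := fun a =>
  V.fic.trans (V.fic.symm hst) (V.fic.trans (h a) (V.fic.add a hst))

theorem IsZero.add (h : V.IsZero s) (u : Multiset ℕ) : V.IsZero (s + u) := h.of_r (h u)

theorem IsZero.mono (h : V.IsZero s) (hst : s ≤ t) : V.IsZero t := by
  obtain ⟨u, rfl⟩ := Multiset.le_iff_exists_add.1 hst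
  exact h.add u

theorem IsZero.r (h : V.IsZero s) (h' : V.IsZero t) : V.r s t :=
  V.fic.trans (h t) (add_comm s t ▸ V.fic.symm (h' s))

theorem IsZero.bind (h : V.IsZero s) {f : ℕ → Multiset ℕ} (hf : ∀ i, f i ≠ 0) :
    V.IsZero (s.bind f) := by
  intro a
  by_cases ha : a = 0
  · rw [ha, add_zero]
    exact V.fic.refl _
  obtain ⟨z, hz⟩ := exists_notMem s
  have := V.fic.bind (Function.update f z a) (fun i => by
    by_cases hi : i = z
    · subst hi; simpa using ha
    · simpa [hi] using hf i) (h {z})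
  rwa [Multiset.add_bind, Multiset.singleton_bind, bind_update_eq hz, Function.update_self] at this

theorem IsZero.of_le (h : W.IsZero s) (hVW : V ≤ W) : V.IsZero s := fun a =>
  le_iff.1 hVW _ _ (h a)

theorem IsZero.ne_zero (h : V.IsZero s) : s ≠ 0 := by
  rintro rfl
  simpa using V.fic.zero (h {0})

theorem IsZero.pow {m : ℕ} (h : V.IsZero (m • {0})) {i : ℕ} (hi : m ≤ s.count i) : V.IsZero s := by
  have := h.bind (f := fun _ => {i}) (by simp)
  rw [nsmul_bind, Multiset.singleton_bind] at this
  exact this.mono (nsmul_singleton_le_iff.2 hi)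

theorem isZero_of_r_add_singleton {z : ℕ} (hz : z ∉ s) (h : V.r s (s + {z})) : V.IsZero s := by
  intro a
  by_cases ha : a = 0
  · rw [ha, add_zero]
    exact V.fic.refl _
  have := V.fic.bind (Function.update (fun i => {i}) z a) (fun i => by
    by_cases hi : i = z
    · subst hi; simpa using ha
    · simp [hi]) h
  rwa [Multiset.add_bind, Multiset.singleton_bind, bind_update_eq hz, Function.update_self,
    bind_singleton_self] at this

/-- A nil-variety: it satisfies an identity `xᵐ = 0`. -/
def Nil (V : ComVariety) : Prop := ∃ m : ℕ, V.IsZero (m • {0})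

theorem Nil.of_le (h : W.Nil) (hVW : V ≤ W) : V.Nil := h.imp fun _ hm => hm.of_le hVW

/-- If an identity of a nil-variety changes the content, both sides are zero. -/
theorem Nil.isZero_of_mem (h : V.Nil) (hst : V.r s t) {i : ℕ} (hs : i ∈ s) (ht : i ∉ t) :
    V.IsZero s := by
  obtain ⟨m, hm⟩ := h
  have hm0 : m ≠ 0 := by
    rintro rfl
    exact hm.ne_zero (by simp)
  have h1 := V.fic.bind (Function.update (fun i => {i}) i (m • {i})) (fun j => by
    by_cases hj : j = i
    · subst hj; simpa using hm0
    · simp [hj]) hst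
  rw [bind_update_eq ht, bind_singleton_self] at h1
  refine (IsZero.of_r ?_ h1).of_r (V.fic.symm hst)
  obtain ⟨u, rfl⟩ := Multiset.exists_cons_of_mem hs
  rw [Multiset.cons_bind, Function.update_self]
  exact (hm.pow (i := i) (by simp)).add _

theorem Nil.isZero_of_r_add (h : V.Nil) (hst : V.r s (s + t)) (ht : t ≠ 0) : V.IsZero s := by
  obtain ⟨m, hm⟩ := h
  obtain ⟨i, hi⟩ := Multiset.exists_mem_of_ne_zero ht
  refine IsZero.of_r (hm.pow (i := i) ?_) (V.fic.symm (r_add_nsmul hst m))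
  have := Multiset.one_le_count_iff_mem.2 hi
  rw [Multiset.count_add, Multiset.count_nsmul]
  nlinarith

theorem Nil.isZero_of_lt (h : V.Nil) (hst : V.r s t) (hlt : s < t) : V.IsZero s := by
  obtain ⟨u, rfl⟩ := Multiset.le_iff_exists_add.1 hlt.le
  exact h.isZero_of_r_add hst (by rintro rfl; simp at hlt)

end ComVariety

/-! ### Additive congruences of the natural numbers -/

/-- Congruence modulo `n`, as an additive congruence. -/
def modCon (n : ℕ) : AddCon ℕ where
  r a b := a ≡ b [MOD n]
  iseqv := ⟨Nat.ModEq.refl, Nat.ModEq.symm, Nat.ModEq.trans⟩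
  add' := Nat.ModEq.add

/-- The additive congruence identifying all numbers from `m` on. -/
def leCon (m : ℕ) : AddCon ℕ where
  r a b := a = b ∨ m ≤ a ∧ m ≤ b
  iseqv := ⟨fun _ => .inl rfl, fun h => by omega, fun h h' => by omega⟩
  add' h h' := by omega

section AddCon

variable {c : AddCon ℕ} {m n a b : ℕ}

theorem addCon_of_modEq (h : c m (m + n)) (hab : a ≡ b [MOD n]) : c (m + a) (m + b) := by
  wlog hle : a ≤ b generalizing a b
  · exact c.symm (this hab.symm (by omega))
  obtain ⟨k, hk⟩ := (Nat.modEq_iff_dvd' hle).1 hab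
  obtain rfl : b = n * k + a := by omega
  clear hk hab hle
  have key : c m (m + n * k) := by
    induction k with
    | zero => exact c.refl _
    | succ k ih =>
      have := c.add ih (c.refl n)
      rw [add_assoc] at this
      exact c.trans h this
  rw [← add_assoc]
  exact c.add key (c.refl a)

theorem modEq_of_addCon (hn : 1 ≤ n) (h : c m (m + n)) (hmin : ∀ j, 1 ≤ j → j < n → ¬ c m (m + j))
    (hab : c (m + a) (m + b)) : a ≡ b [MOD n] := by
  have hr : c (m + a % n) (m + b % n) :=
    c.trans (addCon_of_modEq h (Nat.mod_modEq a n))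
      (c.trans hab (addCon_of_modEq h (Nat.mod_modEq b n).symm))
  have ha := Nat.mod_lt a hn
  have hb := Nat.mod_lt b hn
  show a % n = b % n
  generalize a % n = a' at *
  generalize b % n = b' at *
  clear hab
  by_contra hne
  wlog hlt : a' < b' generalizing a' b'
  · exact this b' hb a' ha (c.symm hr) (Ne.symm hne) (by omega)
  refine hmin (b' - a') (by omega) (by omega) (c.trans h ?_)
  have h1 := c.add hr (c.refl (n - a'))
  have h2 := c.add h (c.refl (b' - a'))
  rw [show m + a' + (n - a') = m + n by omega,
    show m + b' + (n - a') = m + n + (b' - a') by omega] at h1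
  exact c.trans h1 (c.symm h2)

theorem addCon_double (ha : 1 ≤ a) (hab : a < b) (h : c a b) :
    ∃ N, 1 ≤ N ∧ c N (N + N) := by
  obtain ⟨d, rfl⟩ := Nat.exists_eq_add_of_lt hab
  rw [add_assoc] at h
  refine ⟨a * (d + 1), Nat.mul_pos ha (by omega), ?_⟩
  have := addCon_of_modEq (a := a * d) (b := a * d + a * (d + 1)) h (by simp [Nat.ModEq])
  convert this using 1 <;> ring

end AddCon

namespace ComVariety

variable {V W : ComVariety} {s t u : Multiset ℕ} {m n : ℕ}

/-! ### Group varieties, the cyclic combinatorial varieties, and null semigroups -/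

/-- The variety of Abelian groups of exponent dividing `n`. -/
def groupVar (n : ℕ) : ComVariety := (FIC.ofCounts (modCon n)).toVariety

/-- The variety given by `xᵐ = xᵐ⁺¹`. -/
def combVar (m : ℕ) : ComVariety := (FIC.ofCounts (leCon m)).toVariety

/-- The variety in which every product of at least `k` factors, some factor of which is repeated
more than `n` times, is zero. -/
def powVar (n k : ℕ) : ComVariety :=
  (FIC.ofIdeal (fun s => (∃ i, n < s.count i) ∧ k ≤ s.card) (by simp)
    (fun s u ⟨⟨i, hi⟩, hk⟩ => ⟨⟨i, by rw [Multiset.count_add]; omega⟩, by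
      rw [Multiset.card_add]; omega⟩)
    (fun s f hf ⟨⟨i, hi⟩, hk⟩ => by
      refine ⟨?_, hk.trans (card_le_card_bind s hf)⟩
      obtain ⟨u, rfl⟩ := Multiset.le_iff_exists_add.1 (nsmul_singleton_le_iff.2 hi)
      obtain ⟨j, hj⟩ := Multiset.exists_mem_of_ne_zero (hf i)
      have := Multiset.one_le_count_iff_mem.2 hj
      refine ⟨j, ?_⟩
      rw [Multiset.add_bind, nsmul_bind, Multiset.singleton_bind, Multiset.count_add,
        Multiset.count_nsmul]
      nlinarith)).toVariety

/-- The variety of semigroups in which all products of `k` factors are zero. -/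
def cardVar (k : ℕ) (hk : 0 < k) : ComVariety :=
  (FIC.ofIdeal (fun s => k ≤ s.card) (by simpa using hk.ne')
    (fun s u h => by rw [Multiset.card_add]; omega)
    (fun s f hf h => h.trans (card_le_card_bind s hf))).toVariety

theorem groupVar_r :
    (groupVar n).r s t ↔ (s = 0 ↔ t = 0) ∧ ∀ i, s.count i ≡ t.count i [MOD n] :=
  FIC.toVariety_r _

theorem combVar_r : (combVar m).r s t ↔
    (s = 0 ↔ t = 0) ∧ ∀ i, s.count i = t.count i ∨ m ≤ s.count i ∧ m ≤ t.count i :=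
  FIC.toVariety_r _

theorem powVar_r {k : ℕ} : (powVar n k).r s t ↔ s = t ∨
    ((∃ i, n < s.count i) ∧ k ≤ s.card) ∧ (∃ i, n < t.count i) ∧ k ≤ t.card :=
  FIC.toVariety_r _

theorem powVar_isZero {k : ℕ} : (powVar n k).IsZero s ↔ (∃ i, n < s.count i) ∧ k ≤ s.card := by
  refine ⟨fun h => ((powVar_r.1 (h {0})).resolve_left (by simp)).1, fun h a => powVar_r.2 (.inr
    ⟨h, h.1.imp fun i hi => ?_, ?_⟩)⟩
  · rw [Multiset.count_add]; omega
  · rw [Multiset.card_add]; omega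

theorem cardVar_r {k : ℕ} {hk : 0 < k} :
    (cardVar k hk).r s t ↔ s = t ∨ k ≤ s.card ∧ k ≤ t.card :=
  FIC.toVariety_r _

theorem cardVar_isZero {k : ℕ} {hk : 0 < k} : (cardVar k hk).IsZero s ↔ k ≤ s.card := by
  refine ⟨fun h => ?_, fun h a => cardVar_r.2 (.inr ⟨h, by rw [Multiset.card_add]; omega⟩)⟩
  exact ((cardVar_r.1 (h {0})).resolve_left (by simp)).1

/-- The exponents `a`, `b` for which a variety satisfies `xᵃ = xᵇ`. -/
def powCon (V : ComVariety) : AddCon ℕ where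
  r a b := V.r (a • {0}) (b • {0})
  iseqv := ⟨fun _ => V.fic.refl _, V.fic.symm, V.fic.trans⟩
  add' h h' := by
    rw [add_nsmul, add_nsmul]
    exact V.fic.add_congr h h'

theorem r_nsmul_of_powCon {a b : ℕ} (h : V.powCon a b) (hs : s ≠ 0) : V.r (a • s) (b • s) :=
  r_pow_bind h hs

theorem powCon_of_le (h : V ≤ W) {a b : ℕ} (hab : W.powCon a b) : V.powCon a b :=
  le_iff.1 h _ _ hab

theorem groupVar_powCon (hn : n ≠ 0) {a b : ℕ} (ha : a ≠ 0) (hb : b ≠ 0) :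
    (groupVar n).powCon a b ↔ a ≡ b [MOD n] := by
  refine groupVar_r.trans ⟨fun h => by simpa using h.2 0, fun h => ⟨by simp [ha, hb], fun i => ?_⟩⟩
  by_cases hi : i = 0
  · subst hi; simpa using h
  · simp [Multiset.count_nsmul, Multiset.count_singleton, hi, Nat.ModEq.refl]

theorem r_of_r_union (h : V.r s (s ∪ t)) (h' : V.r t (t ∪ s)) : V.r s t :=
  V.fic.trans h (V.fic.symm (Multiset.union_comm s t ▸ h'))

theorem union_eq_add_sub (s t : Multiset ℕ) : s ∪ t = s + (t - s) := by
  rw [Multiset.union_comm, Multiset.union_def, add_comm]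

/-- A variety without null semigroups satisfies some identity `x = xᵏ⁺¹`. -/
theorem exists_powCon_one (h : ¬ cardVar 2 two_pos ≤ V) : ∃ k, 1 ≤ k ∧ V.powCon 1 (k + 1) := by
  obtain ⟨s, t, hst, hne⟩ := not_le_iff.1 h
  rw [cardVar_r] at hne
  push Not at hne
  wlog hs : s.card < 2 generalizing s t
  · exact this t s (V.fic.symm hst) ⟨hne.1.symm, fun h => by omega⟩ (hne.2 (by omega))
  have hs0 := ne_zero_of_r_of_ne hst hne.1
  have hs1 : s.card = 1 := by
    have := Multiset.card_pos.2 hs0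
    omega
  obtain ⟨i, rfl⟩ := Multiset.card_eq_one.1 hs1
  have ht0 := Multiset.card_pos.2 (mt hst.1.2 hs0)
  by_cases ht : 2 ≤ t.card
  · refine ⟨t.card - 1, by omega, ?_⟩
    have := V.fic.bind (fun _ => {0}) (by simp) hst
    rw [bind_const_eq, bind_const_eq, hs1] at this
    rwa [Nat.sub_add_cancel ht0]
  · obtain ⟨j, rfl⟩ := Multiset.card_eq_one.1 (show t.card = 1 by omega)
    have hij : j ≠ i := fun h => hne.1 (by rw [h])
    have := V.fic.bind (fun j => if j = i then {0} else 2 • {0})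
      (ite_ne_zero (by simp) (by simp) _) hst
    refine ⟨1, le_rfl, ?_⟩
    show V.r (1 • {0}) (2 • {0})
    simpa [hij] using this

/-- A variety without semilattices satisfies some identity `xᵏ = xᵏyᵏ`. -/
theorem exists_r_add (h : ¬ combVar 1 ≤ V) :
    ∃ k : ℕ, 1 ≤ k ∧ V.r (k • {0}) (k • {0} + k • {1}) := by
  obtain ⟨s, t, hst, hne⟩ := not_le_iff.1 h
  rw [combVar_r] at hne
  push Not at hne
  obtain ⟨i, hi, hi'⟩ := hne hst.1
  clear hne
  wlog hs : 1 ≤ s.count i generalizing s t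
  · exact this t s (V.fic.symm hst) hi.symm (by omega) (by omega)
  have ht := hi' hs
  have ht' : t.count i = 0 := by omega
  have h1 := V.fic.bind (fun j => if j = i then {1} else {0})
    (ite_ne_zero (by simp) (by simp) _) (V.fic.symm hst)
  rw [bind_ite_eq, bind_ite_eq, ht', zero_nsmul, zero_add, Nat.sub_zero] at h1
  have hb : 1 ≤ t.card := by
    refine Multiset.card_pos.2 (mt hst.1.2 ?_)
    rintro rfl
    simp at hs
  generalize t.card = b at *
  generalize s.count i = a at *
  generalize s.card - a = c at *
  have h2 (p : Multiset ℕ) (hp : p ≠ 0) : V.r (b • {0}) (a • p + c • {0}) := by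
    have := V.fic.bind (fun j => if j = 1 then p else {0}) (ite_ne_zero hp (by simp) _) h1
    simpa [nsmul_bind] using this
  have h3 : V.powCon b (a + c) := by
    have := h2 {0} (by simp)
    rwa [← add_nsmul] at this
  have h4 : V.powCon b (a * 2 + c) := by
    have := h2 (2 • {0}) (by simp)
    rwa [← mul_nsmul', ← add_nsmul] at this
  refine ⟨a * (b + 1), Nat.mul_pos hs (by omega), ?_⟩
  have hab : b ≤ a * b := Nat.le_mul_of_pos_left b hs
  obtain ⟨Q, hQ⟩ : ∃ Q, a * b = b + Q := Nat.exists_eq_add_of_le hab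
  have hk : a * (b + 1) = b + (Q + a) := by rw [mul_add, hQ]; ring
  have h5 := V.fic.add ((Q + a) • {0}) (h2 ((b + 1) • {1}) (by simp))
  rw [← add_nsmul, ← mul_nsmul', add_assoc, ← add_nsmul, add_comm (_ • _)] at h5
  have h6 : V.powCon (c + (Q + a)) (b + (Q + a)) := by
    have e1 := V.powCon.add (V.powCon.trans (V.powCon.symm h3) h4) (V.powCon.refl Q)
    have e2 := V.powCon.add (V.powCon.symm h3) (V.powCon.refl (Q + a))
    refine V.powCon.trans ?_ e2
    convert e1 using 1 <;> ring
  rw [← hk] at h5 h6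
  exact V.fic.trans h5 (V.fic.add _ h6)

/-- A proper variety satisfies an identity `xᴺ = x²ᴺ`. -/
theorem exists_powCon_double (h : V ≠ ⊤) : ∃ N, 1 ≤ N ∧ V.powCon N (N + N) := by
  rw [Ne, eq_top_iff] at h
  push Not at h
  obtain ⟨s, t, hst, hne⟩ := h
  have hs0 := ne_zero_of_r_of_ne hst hne
  have ht0 := mt hst.1.2 hs0
  have key : ∃ a b, 1 ≤ a ∧ 1 ≤ b ∧ a ≠ b ∧ V.powCon a b := by
    have hs := Multiset.card_pos.2 hs0
    have ht := Multiset.card_pos.2 ht0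
    by_cases hc : s.card = t.card
    · have : ∃ i, s.count i ≠ t.count i := by
        by_contra! H
        exact hne (Multiset.ext.2 H)
      obtain ⟨i, hi⟩ := this
      have h1 := V.fic.bind (fun j => if j = i then 2 • {0} else {0})
        (ite_ne_zero (by simp) (by simp) _) hst
      have hsi := Multiset.count_le_card i s
      have hti := Multiset.count_le_card i t
      rw [bind_ite_eq, bind_ite_eq, ← mul_nsmul', ← mul_nsmul', ← add_nsmul, ← add_nsmul] at h1
      exact ⟨_, _, by omega, by omega, by omega, h1⟩
    · have h1 := V.fic.bind (fun _ => {0}) (by simp) hst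
      rw [bind_const_eq, bind_const_eq] at h1
      exact ⟨_, _, hs, ht, hc, h1⟩
  obtain ⟨a, b, ha, hb, hne, hab⟩ := key
  rcases lt_or_gt_of_ne hne with h | h
  · exact addCon_double ha h hab
  · exact addCon_double hb h (V.powCon.symm hab)

theorem exists_groupVar_le {N : ℕ} (hN : 1 ≤ N) (h : V.powCon N (N + N)) :
    ∃ n, 1 ≤ n ∧ V.powCon N (N + n) ∧ groupVar n ≤ V := by
  classical
  have hex : ∃ n, 1 ≤ n ∧ V.powCon N (N + n) := ⟨N, hN, h⟩
  obtain ⟨n, ⟨hn, hc⟩, hmin⟩ : ∃ n, (1 ≤ n ∧ V.powCon N (N + n)) ∧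
      ∀ j < n, ¬ (1 ≤ j ∧ V.powCon N (N + j)) :=
    ⟨Nat.find hex, Nat.find_spec hex, fun j hj => Nat.find_min hex hj⟩
  refine ⟨n, hn, hc, le_iff.2 fun s t hst => groupVar_r.2 ⟨hst.1, fun i => ?_⟩⟩
  refine modEq_of_addCon hn hc (fun j h1 h2 h3 => hmin j h2 ⟨h1, h3⟩) ?_
  have h1 := V.fic.add (N • {0}) (V.fic.bind (fun j => if j = i then {0} else N • {0})
    (ite_ne_zero (by simp) (nsmul_singleton_ne_zero (by omega) 0) _) hst)
  rw [bind_ite_eq, bind_ite_eq, ← mul_nsmul', ← mul_nsmul', ← add_nsmul, ← add_nsmul,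
    ← add_nsmul, ← add_nsmul] at h1
  have h2 (a d : ℕ) : V.powCon (N + a) (a + d * N + N) := by
    have := addCon_of_modEq (a := a) (b := a + d * N) h (by simp [Nat.ModEq])
    rwa [add_comm N (a + d * N)] at this
  exact V.powCon.trans (h2 _ _) (V.powCon.trans h1 (V.powCon.symm (h2 _ _)))

/-- A variety of periodic groups. -/
def IsGrp (V : ComVariety) : Prop := ∃ n, 1 ≤ n ∧ V = groupVar n

theorem isGrp_of_not_le (h1 : ¬ combVar 1 ≤ V) (h2 : ¬ cardVar 2 two_pos ≤ V) : V.IsGrp := by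
  obtain ⟨k, hk, hk'⟩ := exists_powCon_one h2
  obtain ⟨l, hl, hl'⟩ := exists_r_add h1
  have hN : 1 ≤ k * l := Nat.mul_pos hk hl
  have e1 : V.r {0} ({0} + (k * l) • {0}) := by
    have : V.r {0} ({0} + k • {0}) := by
      rw [← one_nsmul ({0} : Multiset ℕ), ← mul_nsmul', ← add_nsmul, mul_one, add_comm 1]
      exact hk'
    have := r_add_nsmul this l
    rwa [← mul_nsmul', mul_comm l] at this
  have e2 : V.r ((k * l) • {0}) ((k * l) • {0} + (k * l) • {1}) := by
    have := r_nsmul k hl'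
    rwa [nsmul_add, ← mul_nsmul', ← mul_nsmul'] at this
  have e3 : V.r {0} ({0} + (k * l) • {1}) := by
    refine V.fic.trans e1 (V.fic.trans (V.fic.add_left {0} e2) ?_)
    rw [← add_assoc]
    exact V.fic.add _ (V.fic.symm e1)
  generalize k * l = N at *
  have e4 : V.powCon N (N + N) := by
    have := V.fic.bind (fun _ => {0}) (by simp) e2
    rw [Multiset.add_bind, nsmul_bind, nsmul_bind, Multiset.singleton_bind,
      Multiset.singleton_bind, ← add_nsmul] at this
    exact this
  obtain ⟨n, hn, hc, hle⟩ := exists_groupVar_le hN e4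
  have e5 : ∀ s w, s ≠ 0 → V.r s (s + n • w) := by
    intro s w hs
    by_cases hw : w = 0
    · subst hw
      simpa using V.fic.refl s
    have e6 : V.r s (s + N • w) := by
      have := V.fic.bind (fun j => if j = 0 then s else w) (ite_ne_zero hs hw _) e3
      simpa [nsmul_bind] using this
    refine V.fic.trans e6 (V.fic.trans (V.fic.add_left s (r_nsmul_of_powCon hc hw)) ?_)
    rw [add_nsmul, ← add_assoc]
    exact V.fic.add _ (V.fic.symm e6)
  have e7 : ∀ s t, (groupVar n).r s t → s ≠ 0 → V.r s (s ∪ t) := by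
    intro s t h hs
    obtain ⟨u, hu⟩ : ∃ u, t - s = n • u := by
      refine Multiset.exists_smul_of_dvd_count _ fun i hi => ?_
      have h' := (groupVar_r.1 h).2 i
      rw [Multiset.count_sub]
      rcases le_total (s.count i) (t.count i) with hle | hle
      · exact (Nat.modEq_iff_dvd' hle).1 h'
      · simp [Nat.sub_eq_zero_of_le hle]
    rw [union_eq_add_sub, hu]
    exact e5 _ _ hs
  refine ⟨n, hn, le_antisymm (le_iff.2 fun s t h => ?_) hle⟩
  by_cases hs : s = 0
  · subst hs
    rw [(groupVar n).fic.zero h]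
    exact V.fic.refl _
  · exact r_of_r_union (e7 s t h hs) (e7 t s ((groupVar n).fic.symm h) (mt h.1.2 hs))

end ComVariety

namespace ComVariety

variable {V W : ComVariety} {s t u : Multiset ℕ} {m n : ℕ}

/-! ### Atoms -/

theorem groupVar_le_iff (hn : n ≠ 0) : groupVar m ≤ groupVar n ↔ m ∣ n := by
  constructor
  · intro h
    have h1 : (groupVar n).r {0} ((n + 1) • {0}) := by
      refine groupVar_r.2 ⟨by simp, fun i => ?_⟩
      rw [Multiset.count_nsmul, add_mul]
      simp [Nat.ModEq]
    have h2 := (groupVar_r.1 (le_iff.1 h _ _ h1)).2 0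
    rw [Multiset.count_nsmul, Multiset.count_singleton_self, mul_one, add_comm] at h2
    simpa using (Nat.modEq_iff_dvd' (Nat.le_add_right 1 n)).1 h2
  · intro h
    refine le_iff.2 fun s t hst => groupVar_r.2 ?_
    exact (groupVar_r.1 hst).imp_right fun h' i => (h' i).of_dvd h

theorem groupVar_one : groupVar 1 = ⊥ :=
  eq_bot_of_r (groupVar_r.2 ⟨by simp, fun _ => Nat.modEq_one⟩)

theorem groupVar_eq_bot_iff (hn : n ≠ 0) : groupVar n = ⊥ ↔ n = 1 := by
  rw [← groupVar_one]
  refine ⟨fun h => ?_, fun h => by rw [h]⟩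
  exact Nat.dvd_one.1 ((groupVar_le_iff one_ne_zero).1 h.le)

theorem groupVar_inj (hm : m ≠ 0) (hn : n ≠ 0) : groupVar m = groupVar n ↔ m = n :=
  ⟨fun h => Nat.dvd_antisymm ((groupVar_le_iff hn).1 h.le) ((groupVar_le_iff hm).1 h.ge),
    fun h => by rw [h]⟩

theorem not_isZero_groupVar (hn : n ≠ 1) : ¬ (groupVar n).IsZero s := fun h => by
  have := (groupVar_r.1 (h {0})).2 0
  rw [Multiset.count_add, Multiset.count_singleton_self] at this
  exact hn (Nat.dvd_one.1 (by simpa using (Nat.modEq_iff_dvd' (Nat.le_add_right _ 1)).1 this))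

theorem combVar_one_not_le_groupVar (hn : n ≠ 0) : ¬ combVar 1 ≤ groupVar n := fun h => by
  have h1 : (groupVar n).r {0} ({0} + n • {1}) :=
    groupVar_r.2 ⟨by simp, fun i => by
      rw [Multiset.count_add, Multiset.count_nsmul]
      simp [Nat.ModEq]⟩
  have := (combVar_r.1 (le_iff.1 h _ _ h1)).2 1
  simp [hn.symm] at this

theorem cardVar_two_not_le_groupVar (hn : n ≠ 0) : ¬ cardVar 2 two_pos ≤ groupVar n := fun h => by
  have h1 : (groupVar n).powCon 1 (n + 1) :=
    (groupVar_powCon hn one_ne_zero n.succ_ne_zero).2 (by simp [Nat.ModEq])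
  have := cardVar_r.1 (powCon_of_le h h1)
  simp [add_nsmul, hn] at this

theorem isGrp_iff : V.IsGrp ↔ ¬ combVar 1 ≤ V ∧ ¬ cardVar 2 two_pos ≤ V := by
  refine ⟨?_, fun h => isGrp_of_not_le h.1 h.2⟩
  rintro ⟨n, hn, rfl⟩
  exact ⟨combVar_one_not_le_groupVar (by omega), cardVar_two_not_le_groupVar (by omega)⟩

theorem not_nil_combVar_one : ¬ (combVar 1).Nil := fun ⟨m, hm⟩ => by
  have := (combVar_r.1 (hm {1})).2 1
  simp [Multiset.count_singleton] at this

theorem nil_cardVar (k : ℕ) (hk : 0 < k) : (cardVar k hk).Nil := ⟨k, cardVar_isZero.2 (by simp)⟩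

theorem isAtom_combVar_one : IsAtom (combVar 1) := by
  refine ⟨fun h => not_nil_combVar_one (h ▸ (nil_cardVar 1 one_pos).of_le bot_le), fun V hV => ?_⟩
  obtain ⟨k, hk, h⟩ := exists_r_add hV.not_ge
  have h1 : ∀ i : ℕ, V.r {i} (k • {i}) := fun i => by
    refine le_iff.1 hV.le _ _ (combVar_r.2 ⟨by simp; omega, fun j => ?_⟩)
    by_cases hj : j = i
    · subst hj; simp; omega
    · simp [Multiset.count_nsmul, Multiset.count_singleton, hj]
  have h2 : V.r {0} ({0} + {1}) :=
    V.fic.trans (h1 0) (V.fic.trans h (V.fic.symm (V.fic.add_congr (h1 0) (h1 1))))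
  have h3 : V.r {1} ({1} + {0}) := by
    have := V.fic.bind (fun j => if j = 0 then {1} else {0}) (ite_ne_zero (by simp) (by simp) _) h2
    simpa using this
  refine eq_bot_of_r (V.fic.trans h2 (V.fic.symm ?_))
  rwa [add_comm {0}]

theorem isAtom_cardVar_two : IsAtom (cardVar 2 two_pos) := by
  constructor
  · intro h
    have h1 : (cardVar 2 two_pos).r {0} {1} := by rw [h]; exact bot_r (by simp) (by simp)
    simpa using cardVar_r.1 h1
  intro V hV
  obtain ⟨k, hk, h⟩ := exists_powCon_one hV.not_ge
  have h1 (i : ℕ) : V.IsZero {i} := by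
    refine IsZero.of_r ?_ (V.fic.symm (one_nsmul ({i} : Multiset ℕ) ▸
      r_nsmul_of_powCon h (Multiset.singleton_ne_zero i)))
    exact (cardVar_isZero.2 (by simp; omega)).of_le hV.le
  exact eq_bot_of_r ((h1 0).r (h1 1))

theorem IsGrp.of_le_groupVar (hn : n ≠ 0) (h : V ≤ groupVar n) :
    ∃ d, 1 ≤ d ∧ d ∣ n ∧ V = groupVar d := by
  obtain ⟨d, hd, rfl⟩ := isGrp_of_not_le
    (fun h' => combVar_one_not_le_groupVar hn (h'.trans h))
    (fun h' => cardVar_two_not_le_groupVar hn (h'.trans h))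
  exact ⟨d, hd, (groupVar_le_iff hn).1 h, rfl⟩

theorem isAtom_groupVar {q : ℕ} (hq : q.Prime) : IsAtom (groupVar q) := by
  refine ⟨mt (groupVar_eq_bot_iff hq.ne_zero).1 hq.ne_one, fun V hV => ?_⟩
  obtain ⟨d, hd, hdq, rfl⟩ := IsGrp.of_le_groupVar hq.ne_zero hV.le
  rcases (Nat.dvd_prime hq).1 hdq with rfl | rfl
  exacts [groupVar_one, absurd rfl hV.ne]

theorem eq_of_isAtom (hV : IsAtom V) :
    V = combVar 1 ∨ V = cardVar 2 two_pos ∨ ∃ q, q.Prime ∧ V = groupVar q := by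
  by_cases h1 : combVar 1 ≤ V
  · exact .inl (hV.le_iff_eq isAtom_combVar_one.1 |>.1 h1).symm
  by_cases h2 : cardVar 2 two_pos ≤ V
  · exact .inr (.inl (hV.le_iff_eq isAtom_cardVar_two.1 |>.1 h2).symm)
  obtain ⟨n, hn, rfl⟩ := isGrp_of_not_le h1 h2
  have hn1 : n ≠ 1 := fun h => hV.1 ((groupVar_eq_bot_iff (by omega)).2 h)
  obtain ⟨q, hq, hqn⟩ := Nat.exists_prime_and_dvd hn1
  exact .inr (.inr ⟨q, hq, (hV.le_iff_eq (isAtom_groupVar hq).1 |>.1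
    ((groupVar_le_iff (by omega)).2 hqn)).symm⟩)

/-- `a` is the only atom below `V`. -/
def OnlyAtom (a V : ComVariety) : Prop := ∀ b, IsAtom b → b ≤ V → b = a

theorem Nil.onlyAtom (h : V.Nil) : OnlyAtom (cardVar 2 two_pos) V := by
  intro b hb hbV
  have hb' := h.of_le hbV
  rcases eq_of_isAtom hb with rfl | rfl | ⟨q, hq, rfl⟩
  · exact absurd hb' not_nil_combVar_one
  · rfl
  · exact absurd hb'.choose_spec (not_isZero_groupVar hq.ne_one)

/-! ### Combinatorial varieties and nil-varieties -/

/-- A combinatorial variety: it satisfies an identity `xᵐ = xᵐ⁺¹`. -/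
def Comb (V : ComVariety) : Prop := ∃ m, V.powCon m (m + 1)

theorem comb_iff : V.Comb ↔ ∀ G, G.IsGrp → G ≤ V → G = ⊥ := by
  constructor
  · rintro ⟨m, hm⟩ G ⟨n, hn, rfl⟩ h
    have hm0 : m ≠ 0 := by
      rintro rfl
      have : V.r (0 • {0}) ((0 + 1) • {0}) := hm
      rw [zero_nsmul] at this
      simpa using V.fic.zero this
    have h1 := (groupVar_powCon (by omega) hm0 m.succ_ne_zero).1 (powCon_of_le h hm)
    refine (groupVar_eq_bot_iff (by omega)).2 (Nat.dvd_one.1 ?_)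
    simpa using (Nat.modEq_iff_dvd' (Nat.le_add_right m 1)).1 h1
  · intro h
    have hV : V ≠ ⊤ := by
      rintro rfl
      have := h _ ⟨2, by omega, rfl⟩ le_top
      rw [groupVar_eq_bot_iff (by omega)] at this
      omega
    obtain ⟨N, hN, hc⟩ := exists_powCon_double hV
    obtain ⟨n, hn, hn', hle⟩ := exists_groupVar_le hN hc
    obtain rfl := (groupVar_eq_bot_iff (by omega)).1 (h _ ⟨n, hn, rfl⟩ hle)
    exact ⟨N, hn'⟩

theorem powCon_of_succ {a b : ℕ} (h : V.powCon m (m + 1)) (ha : m ≤ a) (hb : m ≤ b) :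
    V.powCon a b := by
  obtain ⟨a, rfl⟩ := Nat.exists_eq_add_of_le ha
  obtain ⟨b, rfl⟩ := Nat.exists_eq_add_of_le hb
  exact addCon_of_modEq h Nat.modEq_one

theorem nil_iff : V.Nil ↔ V.Comb ∧ ¬ combVar 1 ≤ V := by
  constructor
  · intro h
    refine ⟨?_, fun h' => not_nil_combVar_one (h.of_le h')⟩
    obtain ⟨m, hm⟩ := h
    refine ⟨m, ?_⟩
    have := hm {0}
    rwa [← succ_nsmul] at this
  · rintro ⟨⟨m, hm⟩, h⟩
    obtain ⟨k, hk, hk'⟩ := exists_r_add h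
    refine ⟨m * k, isZero_of_r_add_singleton (z := 1) (by simp [Multiset.mem_nsmul]) ?_⟩
    have h1 := r_nsmul m hk'
    rw [nsmul_add, ← mul_nsmul', ← mul_nsmul'] at h1
    have hmk : m ≤ m * k := Nat.le_mul_of_pos_right m hk
    have h2 := r_nsmul_of_powCon (powCon_of_succ hm hmk (hmk.trans (Nat.le_succ _)))
      (Multiset.singleton_ne_zero 1)
    refine V.fic.trans h1 (V.fic.trans (V.fic.add_left _ h2) ?_)
    rw [Nat.succ_eq_add_one, succ_nsmul, ← add_assoc]
    exact V.fic.add _ (V.fic.symm h1)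

theorem le_combVar (h : V.powCon m (m + 1)) : V ≤ combVar m := by
  have key : ∀ s t, (combVar m).r s t → V.r s (s ∪ t) := by
    intro s t hst
    rw [union_eq_add_sub]
    have h1 : ∀ i ∈ t - s, m ≤ s.count i := by
      intro i hi
      have := Multiset.one_le_count_iff_mem.2 hi
      rw [Multiset.count_sub] at this
      have := (combVar_r.1 hst).2 i
      omega
    generalize t - s = u at h1 ⊢
    induction u using Multiset.induction_on with
    | empty => simpa using V.fic.refl s
    | cons i u ih =>
      refine V.fic.trans (ih fun j hj => h1 j (Multiset.mem_cons_of_mem hj)) ?_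
      obtain ⟨v, rfl⟩ := Multiset.le_iff_exists_add.1
        (nsmul_singleton_le_iff.2 (h1 i (Multiset.mem_cons_self i u)))
      have h2 := V.fic.add (v + u) (r_nsmul_of_powCon h (Multiset.singleton_ne_zero i))
      rw [succ_nsmul] at h2
      rw [← Multiset.singleton_add]
      convert h2 using 1 <;> abel
  refine le_iff.2 fun s t h => r_of_r_union (key s t h) (key t s ((combVar m).fic.symm h))

theorem combVar_powCon (hm : m ≠ 0) : (combVar m).powCon m (m + 1) := by
  refine combVar_r.2 ⟨by simp [hm], fun i => ?_⟩
  by_cases hi : i = 0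
  · subst hi; simp
  · simp [Multiset.count_nsmul, Multiset.count_singleton, hi]

/-! ### Definability of the basic classes -/

theorem isPredDef_isAtom : IsPredDef (IsAtom : ComVariety → Prop) := by
  intro n t ht
  have : IsLatDef n fun v => ¬ (∀ x, t v ≤ x) ∧ ∀ y, y ≤ t v → ¬ t v ≤ y → ∀ x, y ≤ x :=
    .and (.not (.all (.le ht.init (.last _)))) (.all (.imp (.le (.last _) ht.init)
      (.imp (.not (.le ht.init (.last _))) (.all (.le (.init (.last _)) (.last _))))))
  refine this.congr fun v => and_congr (not_congr ?_) ⟨fun h y hy => ?_, fun h y h1 h2 x => ?_⟩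
  · exact ⟨fun h => le_bot_iff.1 (h _), fun h => by simp [h]⟩
  · exact le_bot_iff.1 (h y hy.le hy.not_ge _)
  · rw [h y (lt_of_le_not_ge h1 h2)]
    exact bot_le

theorem isRelDef_onlyAtom : IsRelDef OnlyAtom := fun _ _ _ hs ht =>
  .all (.imp (isPredDef_isAtom _ _ (.last _)) (.imp (.le (.last _) ht.init)
    (.eq (.last _) hs.init)))

end ComVariety

namespace ComVariety

variable {V W : ComVariety} {s t u : Multiset ℕ} {m n : ℕ}

theorem nil_powVar (n k : ℕ) : (powVar n k).Nil :=
  ⟨n + 1 + k, powVar_isZero.2 ⟨⟨0, by simp; omega⟩, by simp⟩⟩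

theorem le_combVar_one_of_onlyAtom (h : OnlyAtom (combVar 1) V) : V ≤ combVar 1 := by
  have hZM : ¬ cardVar 2 two_pos ≤ V := fun h' =>
    not_nil_combVar_one (h _ isAtom_cardVar_two h' ▸ nil_cardVar _ _)
  have hC : V.Comb := by
    rw [comb_iff]
    rintro G ⟨n, hn, rfl⟩ hG
    by_contra hne
    rw [groupVar_eq_bot_iff (by omega)] at hne
    obtain ⟨q, hq, hqn⟩ := Nat.exists_prime_and_dvd hne
    exact combVar_one_not_le_groupVar hq.ne_zero
      (h _ (isAtom_groupVar hq) (((groupVar_le_iff (by omega)).2 hqn).trans hG)).ge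
  obtain ⟨m, hm⟩ := hC
  obtain ⟨k, hk, hc⟩ := exists_powCon_one hZM
  rw [add_comm] at hc
  have h1 : V.powCon 1 (1 + m * k) := by
    have := addCon_of_modEq (a := 0) (b := m * k) hc (by simp [Nat.ModEq])
    simpa using this
  have hmk : m ≤ m * k := Nat.le_mul_of_pos_right m hk
  refine le_combVar (V.powCon.trans h1 (V.powCon.trans ?_
    (V.powCon.symm (V.powCon.add h1 (V.powCon.refl 1)))))
  exact powCon_of_succ hm (by omega) (by omega)

theorem eq_combVar_one_iff :
    V = combVar 1 ↔ IsAtom V ∧ ∀ W, OnlyAtom V W → W ≤ V := by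
  constructor
  · rintro rfl
    exact ⟨isAtom_combVar_one, fun W => le_combVar_one_of_onlyAtom⟩
  rintro ⟨hV, h⟩
  rcases eq_of_isAtom hV with rfl | rfl | ⟨q, hq, rfl⟩
  · rfl
  · have := h _ (nil_cardVar 3 three_pos).onlyAtom
    have h1 : (cardVar 2 two_pos).IsZero (2 • {0}) := cardVar_isZero.2 (by simp)
    have := cardVar_isZero.1 (h1.of_le this)
    simp at this
  · have hq2 : q ^ 2 ≠ 0 := pow_ne_zero 2 hq.ne_zero
    have := h (groupVar (q ^ 2)) fun b hb hbq => by
      obtain ⟨d, hd, hdq, rfl⟩ := IsGrp.of_le_groupVar hq2 hbq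
      rcases eq_of_isAtom hb with h1 | h1 | ⟨p, hp, h1⟩
      · exact absurd h1.ge (combVar_one_not_le_groupVar (by omega))
      · exact absurd h1.ge (cardVar_two_not_le_groupVar (by omega))
      · obtain rfl := (groupVar_inj (by omega) hp.ne_zero).1 h1
        rw [(Nat.prime_dvd_prime_iff_eq hp hq).1 (hp.dvd_of_dvd_pow hdq)]
    have := Nat.le_of_dvd hq.pos ((groupVar_le_iff hq.ne_zero).1 this)
    have := hq.one_lt
    nlinarith

theorem isChain_of_onlyAtom_groupVar {q : ℕ} (hq : q.Prime) (h : OnlyAtom (groupVar q) V) :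
    ∃ i, V = groupVar (q ^ i) := by
  have h1 : ¬ combVar 1 ≤ V := fun h' =>
    combVar_one_not_le_groupVar hq.ne_zero (h _ isAtom_combVar_one h').le
  have h2 : ¬ cardVar 2 two_pos ≤ V := fun h' =>
    cardVar_two_not_le_groupVar hq.ne_zero (h _ isAtom_cardVar_two h').le
  obtain ⟨n, hn, rfl⟩ := isGrp_of_not_le h1 h2
  refine ⟨_, congrArg groupVar (Nat.eq_prime_pow_of_unique_prime_dvd (p := q) (by omega) ?_)⟩
  intro d hd hdn
  exact (groupVar_inj hd.ne_zero hq.ne_zero).1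
    (h _ (isAtom_groupVar hd) ((groupVar_le_iff (by omega)).2 hdn))

theorem eq_cardVar_two_iff :
    V = cardVar 2 two_pos ↔ IsAtom V ∧ V ≠ combVar 1 ∧
      ∃ U, OnlyAtom V U ∧ ∃ W, OnlyAtom V W ∧ ¬ U ≤ W ∧ ¬ W ≤ U := by
  constructor
  · rintro rfl
    refine ⟨isAtom_cardVar_two, fun h => not_nil_combVar_one (h ▸ nil_cardVar _ _),
      cardVar 3 three_pos, (nil_cardVar _ _).onlyAtom, powVar 1 0, (nil_powVar _ _).onlyAtom,
      fun h => ?_, fun h => ?_⟩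
    · have h1 : (powVar 1 0).IsZero (2 • {0}) := powVar_isZero.2 ⟨⟨0, by simp⟩, by simp⟩
      have := cardVar_isZero.1 (h1.of_le h)
      simp at this
    · have h1 : (cardVar 3 three_pos).IsZero ({0} + {1} + {2}) := cardVar_isZero.2 (by simp)
      obtain ⟨⟨i, hi⟩, -⟩ := powVar_isZero.1 (h1.of_le h)
      simp only [Multiset.count_add, Multiset.count_singleton] at hi
      split_ifs at hi <;> omega
  · rintro ⟨hV, hne, U, hU, W, hW, h1, h2⟩
    rcases eq_of_isAtom hV with rfl | rfl | ⟨q, hq, rfl⟩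
    · exact absurd rfl hne
    · rfl
    · obtain ⟨i, rfl⟩ := isChain_of_onlyAtom_groupVar hq hU
      obtain ⟨j, rfl⟩ := isChain_of_onlyAtom_groupVar hq hW
      rw [groupVar_le_iff (pow_ne_zero _ hq.ne_zero)] at h1 h2
      rcases le_total i j with h | h
      exacts [absurd (pow_dvd_pow q h) h1, absurd (pow_dvd_pow q h) h2]

theorem isPredDef_combVar_one : IsPredDef (· = combVar 1) :=
  IsPredDef.congr (fun _ _ ht => .and (isPredDef_isAtom _ _ ht)
    (.all (.imp (isRelDef_onlyAtom _ _ _ ht.init (.last _)) (.le (.last _) ht.init))))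
    fun _ => eq_combVar_one_iff.symm

theorem isPredDef_cardVar_two : IsPredDef (· = cardVar 2 two_pos) :=
  IsPredDef.congr (fun _ _ ht => .and (isPredDef_isAtom _ _ ht) (.and
    (.not (isPredDef_combVar_one _ _ ht))
    (.ex (.and (isRelDef_onlyAtom _ _ _ ht.init (.last _)) (.ex (.and
      (isRelDef_onlyAtom _ _ _ ht.init.init (.last _)) (.and
        (.not (.le (.init (.last _)) (.last _))) (.not (.le (.last _) (.init (.last _)))))))))))
    fun _ => eq_cardVar_two_iff.symm

theorem isPredDef_isGrp : IsPredDef IsGrp := by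
  refine IsPredDef.congr (fun n t ht => ?_) fun _ => isGrp_iff.symm
  exact .and (.not (isPredDef_combVar_one.ge _ _ ht)) (.not (isPredDef_cardVar_two.ge _ _ ht))

theorem isPredDef_comb : IsPredDef Comb := by
  refine IsPredDef.congr (fun n t ht => ?_) fun _ => comb_iff.symm
  exact .all (.imp (isPredDef_isGrp _ _ (.last _)) (.imp (.le (.last _) ht.init)
    (isPredDef_eq_bot _ _ (.last _))))

theorem isPredDef_nil : IsPredDef Nil := by
  refine IsPredDef.congr (fun n t ht => ?_) fun _ => nil_iff.symm
  exact .and (isPredDef_comb _ _ ht) (.not (isPredDef_combVar_one.ge _ _ ht))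

end ComVariety

namespace ComVariety

variable {V W : ComVariety} {s t u : Multiset ℕ} {m n : ℕ}

/-! ### Splitting off a group variety from the nil-subvarieties of a join -/

/-- The multiset of letters of the word `xᵢⁿ⁺¹xⱼ`. -/
def powMul (n i j : ℕ) : Multiset ℕ := (n + 1) • {i} + {j}

theorem powMul_bind (n i j : ℕ) (f : ℕ → Multiset ℕ) :
    (powMul n i j).bind f = (n + 1) • f i + f j := by
  rw [powMul, Multiset.add_bind, nsmul_bind, Multiset.singleton_bind, Multiset.singleton_bind]

theorem powMul_bind_ite {i j : ℕ} (hij : i ≠ j) (n k l : ℕ) :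
    ((powMul n i j).bind fun x => if x = i then {k} else {l}) = powMul n k l := by
  rw [powMul_bind, if_pos rfl, if_neg hij.symm, powMul]

theorem powMul_le {i j : ℕ} (hij : i ≠ j) (hi : n + 1 ≤ s.count i) (hj : j ∈ s) :
    powMul n i j ≤ s := by
  have := Multiset.one_le_count_iff_mem.2 hj
  refine Multiset.le_iff_count.2 fun k => ?_
  rw [powMul, Multiset.count_add, Multiset.count_nsmul, Multiset.count_singleton,
    Multiset.count_singleton]
  by_cases hk : k = i
  · subst hk
    simpa [hij] using hi
  · by_cases hk' : k = j
    · subst hk'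
      simpa [hk, Multiset.one_le_count_iff_mem] using hj
    · simp [hk, hk']

theorem mem_powMul {i j k : ℕ} : k ∈ powMul n i j ↔ k = i ∨ k = j := by
  simp [powMul, Multiset.mem_nsmul]

theorem powMul_ne_zero (n i j : ℕ) : powMul n i j ≠ 0 := by simp [powMul]

theorem IsZero.powMul {i j k l : ℕ} (h : V.IsZero (powMul n i j)) (hij : i ≠ j) :
    V.IsZero (ComVariety.powMul n k l) := by
  have := h.bind (f := fun x => if x = i then {k} else {l}) (ite_ne_zero (by simp) (by simp) _)
  rwa [powMul_bind_ite hij] at this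

/-- Every nil-variety in the join of `G`, a variety of periodic groups and a nil-subvariety `N`
of `V` lies in the join of `G` and `N`. -/
def Splits (G V : ComVariety) : Prop :=
  ∀ N, N.Nil → N ≤ V → ∀ H, H.IsGrp → ∀ M, M.Nil → M ≤ G ⊔ H ⊔ N → M ≤ G ⊔ N

theorem splits_of_isZero (hn : 1 ≤ n) (h : V.IsZero (powMul n 0 1)) : Splits (groupVar n) V := by
  rintro N hN hNV H ⟨h', hh, rfl⟩ M hM hle
  have h0 : n * h' ≠ 0 := (Nat.mul_pos hn hh).ne'
  refine le_iff.2 fun s t hst => ?_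
  obtain ⟨hg, hNr⟩ := sup_r.1 hst
  have key1 : ∀ s, N.IsZero s → M.IsZero s := by
    intro s hs
    have hg' (k : ℕ) (hk : k ∣ n * h') : (groupVar k).r s (s + (n * h') • {0}) := by
      refine groupVar_r.2 ⟨by simp [hs.ne_zero], fun i => ?_⟩
      rw [Multiset.count_add, Multiset.count_nsmul]
      have := (Nat.modEq_zero_iff_dvd.2 (dvd_mul_of_dvd_left hk (Multiset.count i {0}))).symm
      simpa using (Nat.ModEq.refl (s.count i)).add this
    refine hM.isZero_of_r_add (le_iff.1 hle _ _ (sup_r.2 ⟨sup_r.2 ⟨hg' n (dvd_mul_right _ _),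
      hg' h' (dvd_mul_left _ _)⟩, hs _⟩)) (nsmul_singleton_ne_zero h0 0)
  by_cases hne : s = t
  · rw [hne]
    exact M.fic.refl _
  suffices hz : N.IsZero s ∨ N.IsZero t by
    rcases hz with hz | hz
    · exact (key1 s hz).r (key1 t (hz.of_r hNr))
    · exact (key1 s (hz.of_r (N.fic.symm hNr))).r (key1 t hz)
  have hc : ∃ i, s.count i ≠ t.count i := by
    by_contra! H
    exact hne (Multiset.ext.2 H)
  obtain ⟨i, hi⟩ := hc
  clear hst hne hle key1
  wlog hlt : t.count i < s.count i generalizing s t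
  · exact (this t s ((groupVar n).fic.symm hg) (N.fic.symm hNr) (Ne.symm hi) (by omega)).symm
  have his : i ∈ s := Multiset.count_pos.1 (by omega)
  by_cases hit : i ∈ t
  swap
  · exact .inl (hN.isZero_of_mem hNr his hit)
  have hdvd := (Nat.modEq_iff_dvd' hlt.le).1 ((groupVar_r.1 hg).2 i).symm
  have hle := Nat.le_of_dvd (by omega) hdvd
  have hit' := Multiset.one_le_count_iff_mem.2 hit
  by_cases hj : ∃ j ∈ s, i ≠ j
  · obtain ⟨j, hj, hij⟩ := hj
    exact .inl (((h.of_le hNV).powMul (by simp)).mono (powMul_le hij (by omega) hj))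
  push Not at hj
  by_cases hj' : ∃ j ∈ t, j ∉ s
  · obtain ⟨j, hj1, hj2⟩ := hj'
    exact .inr (hN.isZero_of_mem (N.fic.symm hNr) hj1 hj2)
  push Not at hj'
  refine .inr (hN.isZero_of_lt (N.fic.symm hNr) (lt_of_le_of_ne ?_ ?_))
  · refine Multiset.le_iff_count.2 fun j => ?_
    by_cases hjt : j ∈ t
    · rw [← hj j (hj' j hjt)]
      exact hlt.le
    · rw [Multiset.count_eq_zero_of_notMem hjt]
      exact Nat.zero_le _
  · rintro rfl
    exact hi rfl

/-- In a nil-variety without the identity `xⁿ⁺¹y = 0`, applying the identity `xⁿ⁺¹y = yⁿ⁺¹x`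
to a word equal to one of its sides leads to one of its sides. -/
theorem powMul_step (hV : V.Nil) (hz : ¬ V.IsZero (powMul n 0 1)) {a p q : Multiset ℕ}
    (hp : p ≠ 0) (hq : q ≠ 0)
    (h : V.r (powMul n 0 1) (a + ((n + 1) • p + q)) ∨ V.r (powMul n 1 0) (a + ((n + 1) • p + q))) :
    V.r (powMul n 0 1) (a + ((n + 1) • q + p)) ∨ V.r (powMul n 1 0) (a + ((n + 1) • q + p)) := by
  obtain ⟨i, j, hE, hr⟩ : ∃ i j, (i = 0 ∧ j = 1 ∨ i = 1 ∧ j = 0) ∧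
      V.r (powMul n i j) (a + ((n + 1) • p + q)) := by
    rcases h with h | h
    exacts [⟨0, 1, by simp, h⟩, ⟨1, 0, by simp, h⟩]
  clear h
  have hij : i ≠ j := by omega
  have hz' : ¬ V.IsZero (powMul n i j) := fun h => hz (h.powMul hij)
  obtain ⟨k, hk⟩ := Multiset.exists_mem_of_ne_zero hp
  have hk1 := Multiset.one_le_count_iff_mem.2 hk
  set s := a + ((n + 1) • p + q) with hs
  have hks : n + 1 ≤ s.count k := by
    rw [hs, Multiset.count_add, Multiset.count_add, Multiset.count_nsmul]
    nlinarith
  have hsub : ∀ x ∈ s, x = i ∨ x = j := by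
    intro x hx
    by_contra hx'
    exact hz' ((hV.isZero_of_mem (V.fic.symm hr) hx (mt mem_powMul.1 hx')).of_r (V.fic.symm hr))
  have hsup : ∀ x, x = i ∨ x = j → x ∈ s := by
    intro x hx
    by_contra hx'
    exact hz' (hV.isZero_of_mem hr (mem_powMul.2 hx) hx')
  obtain ⟨l, hkl⟩ : ∃ l, k = i ∧ l = j ∨ k = j ∧ l = i := by
    rcases hsub k (Multiset.count_pos.1 (by omega)) with h | h
    exacts [⟨j, .inl ⟨h, rfl⟩⟩, ⟨i, .inr ⟨h, rfl⟩⟩]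
  have hls : l ∈ s := hsup l (by omega)
  obtain ⟨c, hc⟩ := Multiset.le_iff_exists_add.1 (powMul_le (i := k) (by omega) hks hls)
  by_cases hc0 : c = 0
  · rw [hc0, add_zero] at hc
    have hcard := congrArg Multiset.card hc
    simp only [hs, powMul, Multiset.card_add, Multiset.card_nsmul, Multiset.card_singleton,
      smul_eq_mul] at hcard
    have hp1 := Multiset.card_pos.2 hp
    have hq1 := Multiset.card_pos.2 hq
    have hp2 : p.card = 1 := by nlinarith
    rw [hp2] at hcard
    obtain ⟨k', rfl⟩ := Multiset.card_eq_one.1 hp2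
    obtain ⟨l', rfl⟩ := Multiset.card_eq_one.1 (show q.card = 1 by omega)
    obtain rfl := Multiset.card_eq_zero.1 (show a.card = 0 by omega)
    obtain rfl := Multiset.mem_singleton.1 hk
    have hll : l = l' := by
      rw [hs, zero_add] at hls
      have := mem_powMul.1 hls
      omega
    subst hll
    rw [zero_add]
    rcases (by omega : l = 0 ∧ k = 1 ∨ l = 1 ∧ k = 0) with ⟨rfl, rfl⟩ | ⟨rfl, rfl⟩
    exacts [.inl (V.fic.refl _), .inr (V.fic.refl _)]
  · exfalso
    rw [hc] at hr
    rcases hkl with ⟨rfl, rfl⟩ | ⟨rfl, rfl⟩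
    · exact hz' (hV.isZero_of_r_add hr hc0)
    · have h1 := V.fic.bind (fun x => if x = l then {k} else {l})
        (ite_ne_zero (by simp) (by simp) _) hr
      rw [Multiset.add_bind, powMul_bind_ite hij, powMul_bind n k l, if_pos rfl, if_neg hij.symm,
        ← powMul] at h1
      have h2 := V.fic.trans hr (V.fic.add c h1)
      rw [add_assoc] at h2
      exact hz' (hV.isZero_of_r_add h2 (by simp [hc0]))

theorem isZero_of_splits (hn : 1 ≤ n) (hV : V.Nil) (h : Splits (groupVar n) V) :
    V.IsZero (powMul n 0 1) := by
  by_contra hz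
  set w := powMul n 0 1
  set w' := powMul n 1 0
  have hw : w ≠ 0 := powMul_ne_zero _ _ _
  have hw' : w' ≠ 0 := powMul_ne_zero _ _ _
  set N := V.adj w w'
  have hNz : ¬ N.IsZero w := by
    intro hN
    have hB : (V.r w w ∨ V.r w' w) ↔ (V.r w (w + w') ∨ V.r w' (w + w')) :=
      adj_inv (P := fun s => V.r w s ∨ V.r w' s)
        (fun s t hst => Or.imp (fun h => V.fic.trans h hst) fun h => V.fic.trans h hst)
        (fun a f hf => by
          simp only [w, w', powMul_bind]
          exact ⟨powMul_step hV hz (hf _) (hf _), powMul_step hV hz (hf _) (hf _)⟩) (hN w')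
    rcases hB.1 (.inl (V.fic.refl w)) with h1 | h1
    · exact hz (hV.isZero_of_r_add h1 hw')
    · rw [add_comm] at h1
      exact hz ((hV.isZero_of_r_add h1 hw).powMul (by simp))
  obtain ⟨m, hm⟩ := hV
  set U := groupVar n ⊔ groupVar (n + 1) ⊔ N with hU
  set M := U.adj (m • {0}) (m • {0} + {1})
  have hm0 : m • ({0} : Multiset ℕ) ≠ 0 := hm.ne_zero
  have hM : M.IsZero (m • {0}) := isZero_of_r_add_singleton (z := 1)
    (by simp [Multiset.mem_nsmul]) (adj_r hm0 (by simp))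
  have hNm : N.IsZero (m • {0}) := hm.of_le adj_le
  have hMN := h N ⟨m, hNm⟩ adj_le _ ⟨n + 1, by omega, rfl⟩ M ⟨m, hM⟩ adj_le
  have hMw : M.r w w' := by
    refine le_iff.1 hMN _ _ (sup_r.2 ⟨groupVar_r.2 ⟨by simp [hw, hw'], fun i => ?_⟩, adj_r hw hw'⟩)
    simp only [w, w', powMul, Multiset.count_add, Multiset.count_nsmul]
    have (x y : ℕ) : n * x + (x + y) ≡ n * y + (x + y) [MOD n] := by simp [Nat.ModEq]
    convert this (({0} : Multiset ℕ).count i) (({1} : Multiset ℕ).count i) using 1 <;>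
      ring
  have hP : U.r w w ↔ U.r w w' := by
    refine adj_inv (P := fun s => U.r w s) (fun s t hst hs => U.fic.trans hs hst)
      (fun a f hf => ?_) hMw
    have hno : ∀ x, ¬ U.r w (a + ((m • ({0} : Multiset ℕ)).bind f + x)) := by
      intro x hx
      rw [add_left_comm] at hx
      exact hNz (((hNm.bind hf).add _).of_r (N.fic.symm (sup_r.1 hx).2))
    refine iff_of_false ?_ ?_
    · simpa using hno 0
    · rw [Multiset.add_bind]
      exact hno _
  have h1 := (groupVar_r.1 (sup_r.1 (sup_r.1 (hP.1 (U.fic.refl _))).1).2).2 0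
  simp only [w, w', powMul, Multiset.count_add, Multiset.count_nsmul] at h1
  simp [Nat.ModEq, Nat.mod_eq_of_lt (show 1 < n + 1 by omega)] at h1

theorem splits_iff (hn : 1 ≤ n) (hV : V.Nil) :
    Splits (groupVar n) V ↔ V.IsZero (powMul n 0 1) :=
  ⟨isZero_of_splits hn hV, splits_of_isZero hn⟩

theorem isRelDef_splits : IsRelDef Splits := fun _ _ _ hs ht =>
  .all (.imp (isPredDef_nil _ _ (.last _)) (.imp (.le (.last _) ht.init)
    (.all (.imp (isPredDef_isGrp _ _ (.last _)) (.all (.imp (isPredDef_nil _ _ (.last _)) (.imp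
      (.le (.last _) (.sup (.sup hs.init.init.init (.init (.last _))) (.init (.init (.last _)))))
      (.le (.last _) (.sup hs.init.init.init (.init (.init (.last _))))))))))))

end ComVariety

namespace ComVariety

variable {V W : ComVariety} {s t u : Multiset ℕ} {m n k : ℕ}

/-! ### Definability of the varieties of periodic groups -/

/-- Every nil-variety splitting with respect to `G` splits with respect to `H`. -/
def SplitLe (G H : ComVariety) : Prop := ∀ V, V.Nil → Splits G V → Splits H V

theorem splitLe_groupVar (hn : 1 ≤ n) (hk : 1 ≤ k) :
    SplitLe (groupVar n) (groupVar k) ↔ n ≤ k := by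
  refine ⟨fun h => ?_, fun h V hV hs => ?_⟩
  · have h1 := h _ (nil_powVar n (n + 2))
      ((splits_iff hn (nil_powVar n (n + 2))).2 (powVar_isZero.2 ⟨⟨0, by simp [powMul]⟩,
        by simp [powMul]⟩))
    obtain ⟨⟨i, hi⟩, -⟩ := powVar_isZero.1 ((splits_iff hk (nil_powVar n (n + 2))).1 h1)
    rw [powMul, Multiset.count_add, Multiset.count_nsmul, Multiset.count_singleton,
      Multiset.count_singleton] at hi
    by_cases h0 : i = 0
    · subst h0
      simp at hi
      omega
    · have : (if i = 1 then 1 else 0) ≤ 1 := by split_ifs <;> omega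
      simp [h0] at hi
      omega
  · refine (splits_iff hk hV).2 (((splits_iff hn hV).1 hs).mono ?_)
    rw [powMul, powMul]
    exact add_le_add_left (nsmul_le_nsmul_left (Multiset.zero_le _) (by omega)) _

theorem isRelDef_splitLe : IsRelDef SplitLe := fun _ _ _ hs ht =>
  .all (.imp (isPredDef_nil _ _ (.last _)) (.imp (isRelDef_splits _ _ _ hs.init (.last _))
    (isRelDef_splits _ _ _ ht.init (.last _))))

theorem eq_groupVar_iff (hn : 1 ≤ n) : V = groupVar n ↔
    V.IsGrp ∧ (∀ j < n, 1 ≤ j → V ≠ groupVar j) ∧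
      ∀ W, W.IsGrp → (∀ j < n, 1 ≤ j → W ≠ groupVar j) → SplitLe V W := by
  constructor
  · rintro rfl
    refine ⟨⟨n, hn, rfl⟩, fun j hj hj1 h => ?_, ?_⟩
    · have := (groupVar_inj (by omega) (by omega)).1 h
      omega
    · rintro _ ⟨k, hk, rfl⟩ h
      refine (splitLe_groupVar hn hk).2 ?_
      by_contra! hlt
      exact h k hlt hk rfl
  · rintro ⟨⟨k, hk, rfl⟩, h1, h2⟩
    have h3 := (splitLe_groupVar hk hn).1 (h2 _ ⟨n, hn, rfl⟩ fun j hj hj1 h => by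
      have := (groupVar_inj (by omega) (by omega)).1 h
      omega)
    have h4 : n ≤ k := by
      by_contra! hlt
      exact h1 k hlt hk rfl
    rw [h4.antisymm h3]

theorem isPredDef_groupVar (hn : 1 ≤ n) : IsPredDef (· = groupVar n) := by
  induction n using Nat.strong_induction_on with
  | _ n ih =>
    have hne {l : ℕ} {t : (Fin l → ComVariety) → ComVariety} (ht : IsLatTerm l t) :
        IsLatDef l fun v => ∀ j < n, 1 ≤ j → t v ≠ groupVar j :=
      .forall_lt n fun j hj => by
        by_cases hj1 : 1 ≤ j
        · exact (ih j hj hj1 _ _ ht).not.congr fun v => ⟨fun h _ => h, fun h => h hj1⟩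
        · exact ((IsLatDef.eq ht ht).congr fun v => by simp [hj1])
    refine IsPredDef.congr (fun l t ht => ?_) fun _ => (eq_groupVar_iff hn).symm
    exact .and (isPredDef_isGrp _ _ ht) (.and (hne ht) (.all (.imp (isPredDef_isGrp _ _ (.last _))
      (.imp (hne (.last _)) (isRelDef_splitLe _ _ _ ht.init (.last _))))))

/-! ### Definability of the varieties `xⁿ⁺¹ = 0` -/

theorem le_powVar_zero_iff : V ≤ powVar n 0 ↔ V.IsZero ((n + 1) • {0}) := by
  refine ⟨fun h => (powVar_isZero.2 ⟨⟨0, by simp⟩, Nat.zero_le _⟩ : (powVar n 0).IsZero _).of_le h,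
    fun h => le_iff.2 fun s t hst => ?_⟩
  rcases powVar_r.1 hst with rfl | ⟨⟨⟨i, hi⟩, -⟩, ⟨j, hj⟩, -⟩
  exacts [V.fic.refl _, (h.pow hi).r (h.pow hj)]

theorem count_lt_card_or (hs : n < s.count k) : (∃ j ∈ s, k ≠ j) ∨ s = s.card • {k} := by
  by_cases h : ∃ j ∈ s, k ≠ j
  · exact .inl h
  · push Not at h
    exact .inr (by rw [Multiset.nsmul_singleton]
                   exact Multiset.eq_replicate_card.2 fun j hj => (h j hj).symm)

theorem le_powVar_iff : V ≤ powVar n (n + 2) ↔ V.IsZero (powMul n 0 1) := by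
  refine ⟨fun h => (powVar_isZero.2 ⟨⟨0, by simp [powMul]⟩, by simp [powMul]⟩ :
    (powVar n (n + 2)).IsZero _).of_le h, fun h => le_iff.2 fun s t hst => ?_⟩
  have key : ∀ s : Multiset ℕ, (∃ i, n < s.count i) ∧ n + 2 ≤ s.card → V.IsZero s := by
    rintro s ⟨⟨i, hi⟩, hs⟩
    rcases count_lt_card_or hi with ⟨j, hj, hij⟩ | hs'
    · exact (h.powMul (by simp)).mono (powMul_le hij hi hj)
    · refine (h.powMul (k := i) (l := i) (by simp)).mono ?_
      rw [hs', powMul, ← succ_nsmul]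
      exact nsmul_le_nsmul_left (Multiset.zero_le _) hs
  rcases powVar_r.1 hst with rfl | ⟨h1, h2⟩
  exacts [V.fic.refl _, (key s h1).r (key t h2)]

theorem eq_powVar_iff (hn : 1 ≤ n) : V = powVar n (n + 2) ↔
    V.Nil ∧ Splits (groupVar n) V ∧ ∀ W, W.Nil → Splits (groupVar n) W → W ≤ V := by
  have hD := nil_powVar n (n + 2)
  have hs := (splits_iff hn hD).2 (le_powVar_iff.1 le_rfl)
  constructor
  · rintro rfl
    exact ⟨hD, hs, fun W hW h => le_powVar_iff.2 ((splits_iff hn hW).1 h)⟩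
  · rintro ⟨h1, h2, h3⟩
    exact (le_powVar_iff.2 ((splits_iff hn h1).1 h2)).antisymm (h3 _ hD hs)

theorem isPredDef_powVar (hn : 1 ≤ n) : IsPredDef (· = powVar n (n + 2)) := by
  refine IsPredDef.congr (fun l t ht => ?_) fun _ => (eq_powVar_iff hn).symm
  have key {l : ℕ} {t : (Fin l → ComVariety) → ComVariety} (ht : IsLatTerm l t) :
      IsLatDef l fun v => Splits (groupVar n) (t v) := by
    have : IsLatDef l fun v => ∃ G, G = groupVar n ∧ Splits G (t v) :=
      .ex (.and (isPredDef_groupVar hn _ _ (.last _)) (isRelDef_splits _ _ _ (.last _) ht.init))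
    exact this.congr fun v => by simp
  exact .and (isPredDef_nil _ _ ht) (.and (key ht) (.all (.imp (isPredDef_nil _ _ (.last _))
    (.imp (key (.last _)) (.le (.last _) ht.init)))))

theorem eq_nsmul_of_card_lt (hk : n < s.count k) (hs : s.card < n + 2) : s = (n + 1) • {k} := by
  have h1 := Multiset.count_le_card k s
  have h2 : s.card = n + 1 := by omega
  have h3 : s.count k = s.card := by omega
  rw [← h2, Multiset.nsmul_singleton]
  exact Multiset.eq_replicate_card.2 fun j hj => (Multiset.count_eq_card.1 h3 j hj).symm

theorem isZero_of_r_nsmul (hV : V ≤ powVar n (n + 2)) (h : V.r ((n + 1) • {k}) t)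
    (ht : t ≠ (n + 1) • {k}) (hc : n + 1 ≤ t.card) : V.IsZero ((n + 1) • {0}) := by
  have hN : V.Nil := (nil_powVar _ _).of_le hV
  suffices hz : V.IsZero ((n + 1) • {k}) by
    have := hz.bind (f := fun _ => {0}) (by simp)
    rwa [nsmul_bind, Multiset.singleton_bind] at this
  by_cases h' : ∃ j ∈ t, j ≠ k
  · obtain ⟨j, hj, hjk⟩ := h'
    exact (hN.isZero_of_mem (V.fic.symm h) hj (by simp [Multiset.mem_nsmul, hjk])).of_r
      (V.fic.symm h)
  · push Not at h'
    have ht' : t = t.card • {k} := by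
      rw [Multiset.nsmul_singleton]
      exact Multiset.eq_replicate_card.2 h'
    refine hN.isZero_of_lt h (lt_of_le_of_ne ?_ (Ne.symm ht))
    rw [ht']
    exact nsmul_le_nsmul_left (Multiset.zero_le _) hc

theorem powVar_zero_covBy (n : ℕ) : powVar n 0 ⋖ powVar n (n + 2) := by
  refine covBy_iff_lt_and_eq_or_eq.2 ⟨lt_of_le_of_ne ?_ fun h => ?_, fun X hX hX' => ?_⟩
  · exact le_powVar_iff.2 (powVar_isZero.2 ⟨⟨0, by simp [powMul]⟩, Nat.zero_le _⟩)
  · have := (powVar_isZero.1 (le_powVar_zero_iff.1 h.ge)).2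
    simp at this
  · refine or_iff_not_imp_right.2 fun hne => le_antisymm (le_powVar_zero_iff.2 ?_) hX
    obtain ⟨s, t, hst, hst'⟩ := not_le_iff.1 fun h => hne (hX'.antisymm h)
    have hne : s ≠ t := by
      rintro rfl
      exact hst' ((powVar _ _).fic.refl _)
    obtain ⟨⟨⟨i, hi⟩, -⟩, ⟨j, hj⟩, -⟩ := (powVar_r.1 (le_iff.1 hX _ _ hst)).resolve_left hne
    have hc : s.card < n + 2 ∨ t.card < n + 2 := by
      by_contra! hc
      exact hst' (powVar_r.2 (.inr ⟨⟨⟨i, hi⟩, hc.1⟩, ⟨j, hj⟩, hc.2⟩))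
    have hi' := Multiset.count_le_card i s
    have hj' := Multiset.count_le_card j t
    rcases hc with hc | hc
    · obtain rfl := eq_nsmul_of_card_lt hi hc
      exact isZero_of_r_nsmul hX' hst hne.symm (by omega)
    · obtain rfl := eq_nsmul_of_card_lt hj hc
      exact isZero_of_r_nsmul hX' (X.fic.symm hst) hne (by omega)

theorem covBy_powVar_iff (hn : 1 ≤ n) : V ⋖ powVar n (n + 2) ↔ V = powVar n 0 := by
  refine ⟨fun h => ?_, fun h => h ▸ powVar_zero_covBy n⟩
  obtain ⟨hlt, hbet⟩ := covBy_iff_lt_and_eq_or_eq.1 h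
  have hcov := covBy_iff_lt_and_eq_or_eq.1 (powVar_zero_covBy n)
  suffices hle : V ≤ powVar n 0 by
    exact ((hbet _ hle hcov.1.le).resolve_right hcov.1.ne).symm
  by_contra hle
  rw [le_powVar_zero_iff] at hle
  set D := powVar n (n + 2) with hD
  obtain ⟨s, t, hst, hne, hs, ht⟩ : ∃ s t, V.r s t ∧ s ≠ t ∧ ¬ D.IsZero s ∧
      (D.IsZero t ∨ s.card ≤ t.card) := by
    obtain ⟨s, t, hst, hst'⟩ := not_le_iff.1 hlt.not_ge
    have hne : s ≠ t := by
      rintro rfl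
      exact hst' (D.fic.refl _)
    by_cases hs : D.IsZero s
    · exact ⟨t, s, V.fic.symm hst, hne.symm, fun ht => hst' (hs.r ht), .inl hs⟩
    · by_cases ht : D.IsZero t
      · exact ⟨s, t, hst, hne, hs, .inl ht⟩
      · rcases le_total s.card t.card with hc | hc
        exacts [⟨s, t, hst, hne, hs, .inr hc⟩, ⟨t, s, V.fic.symm hst, hne.symm, ht, .inr hc⟩]
  have hpow : ∀ i, s ≠ (n + 1) • {i} := by
    rintro i rfl
    refine hle (isZero_of_r_nsmul hlt.le hst hne.symm ?_)
    rcases ht with ht | ht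
    · have := (powVar_isZero.1 ht).2
      omega
    · simpa using ht
  have hs0 : s ≠ 0 := ne_zero_of_r_of_ne hst hne
  obtain ⟨z, hz⟩ := exists_notMem (s + t)
  rw [Multiset.mem_add, not_or] at hz
  rcases hbet (D.adj (s + {z}) (t + {z})) (le_adj hlt.le (V.fic.add _ hst)) adj_le with h | h
  · have hinv : s = s ↔ t = s := by
      refine adj_inv (V := D) (P := fun u => u = s) (fun u v huv hu => ?_) (fun a f hf => ?_)
        (h ▸ hst)
      · subst hu
        exact ((powVar_r.1 huv).resolve_right fun h => hs (powVar_isZero.2 h.1)).symm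
      · have hcard : ∀ u : Multiset ℕ, s.card ≤ u.card → a + (u + {z}).bind f ≠ s :=
            fun u hu h => by
          have h1 := congrArg Multiset.card h
          have h2 := card_le_card_bind (u + {z}) hf
          rw [Multiset.card_add] at h1
          rw [Multiset.card_add, Multiset.card_singleton] at h2
          omega
        refine iff_of_false (hcard s le_rfl) ?_
        rcases ht with ht | ht
        · intro h
          rw [Multiset.add_bind, add_left_comm] at h
          exact hs (h ▸ (ht.bind hf).add _)
        · exact hcard t ht
    exact hne (hinv.1 rfl).symm
  · have h1 := adj_r (V := D) (p := s + {z}) (q := t + {z}) (by simp) (by simp)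
    rw [h] at h1
    rcases powVar_r.1 h1 with h2 | ⟨⟨⟨i, hi⟩, -⟩, -⟩
    · exact hne (add_right_cancel h2)
    · have hiz : i ≠ z := by
        rintro rfl
        rw [Multiset.count_add, Multiset.count_eq_zero_of_notMem hz.1] at hi
        simp at hi
        omega
      have hi' : n < s.count i := by simpa [Multiset.count_singleton, hiz] using hi
      refine hpow i (eq_nsmul_of_card_lt hi' ?_)
      by_contra! hc
      exact hs (powVar_isZero.2 ⟨⟨i, hi'⟩, hc⟩)

theorem isPredDef_powVar_zero (hn : 1 ≤ n) : IsPredDef (· = powVar n 0) := by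
  intro l t ht
  have : IsLatDef l fun v => ∃ D, D = powVar n (n + 2) ∧
      (t v ≤ D ∧ t v ≠ D) ∧ ∀ X, t v ≤ X → X ≤ D → ¬ X = t v → X = D :=
    .ex (.and (isPredDef_powVar hn _ _ (.last _)) (.and
      (.and (.le ht.init (.last _)) (.not (.eq ht.init (.last _))))
      (.all (.imp (.le ht.init.init (.last _)) (.imp (.le (.last _) (.init (.last _)))
        (.imp (.not (.eq (.last _) ht.init.init)) (.eq (.last _) (.init (.last _)))))))))
  exact this.congr fun v => by
    show _ ↔ t v = powVar n 0
    rw [← covBy_powVar_iff hn, covBy_iff_lt_and_eq_or_eq]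
    simp [lt_iff_le_and_ne, or_iff_not_imp_left]

/-! ### Definability of the varieties `xᵐ = xᵐ⁺¹` -/

theorem combVar_zero : combVar 0 = ⊥ := eq_bot_of_r (combVar_r.2 ⟨by simp, fun _ => by simp⟩)

theorem IsZero.powCon (h : V.IsZero (m • {0})) : V.powCon m (m + 1) := by
  have := h {0}
  rwa [← succ_nsmul] at this

theorem powCon_of_forall_nil (hV : V.Comb)
    (h : ∀ N, N.Nil → N ≤ V → N.IsZero (m • {0})) : V.powCon m (m + 1) := by
  obtain ⟨k, hk⟩ := hV
  have hk0 : k ≠ 0 := by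
    rintro rfl
    simpa using V.fic.zero (by simpa [ComVariety.powCon] using hk : V.r 0 {0})
  by_cases hc : ∃ c, k ≤ c ∧ V.powCon m c
  · obtain ⟨c, hkc, hc⟩ := hc
    have h1 := V.powCon.add hc (V.powCon.refl 1)
    exact V.powCon.trans hc (V.powCon.trans (powCon_of_succ hk hkc (by omega)) (V.powCon.symm h1))
  exfalso
  set p : Multiset ℕ := k • {0}
  have hp : p ≠ 0 := nsmul_singleton_ne_zero hk0 0
  have hN : (V.adj p (p + {1})).IsZero p := isZero_of_r_add_singleton (z := 1)
    (by simp [p, Multiset.mem_nsmul]) (adj_r hp (by simp))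
  have hno : ∀ a q, q ≠ 0 → ¬ V.r (m • {0}) (a + k • q) := fun a q hq hr => by
    have h1 := V.fic.bind (fun _ => {0}) (by simp) hr
    rw [bind_const_eq, bind_const_eq] at h1
    have h2 : V.powCon m (a + k • q).card := by
      rwa [Multiset.card_nsmul, Multiset.card_singleton, mul_one] at h1
    refine hc ⟨_, ?_, h2⟩
    have := Multiset.card_pos.2 hq
    rw [Multiset.card_add, Multiset.card_nsmul]
    exact (Nat.le_mul_of_pos_right _ this).trans (Nat.le_add_left _ _)
  have hinv : V.r (m • {0}) (m • {0}) ↔ V.r (m • {0}) ((m + k) • {0}) := by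
    refine adj_inv (P := fun s => V.r (m • {0}) s) (fun s t hst hs => V.fic.trans hs hst)
      (fun a f hf => ?_) (p := p) (q := p + {1}) ?_
    · simp only [p, Multiset.add_bind, nsmul_bind, Multiset.singleton_bind]
      refine iff_of_false (hno _ _ (hf _)) ?_
      rw [add_comm (k • f 0), ← add_assoc]
      exact hno _ _ (hf _)
    · rw [add_nsmul]
      exact h _ ⟨k, hN⟩ adj_le p
  have := hinv.1 (V.fic.refl _)
  rw [add_nsmul] at this
  exact hno _ _ (by simp) this

theorem eq_combVar_iff : V = combVar (n + 1) ↔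
    (V.Comb ∧ ∀ N, N.Nil → N ≤ V → N ≤ powVar n 0) ∧
      ∀ W, W.Comb → (∀ N, N.Nil → N ≤ W → N ≤ powVar n 0) → W ≤ V := by
  have hle : ∀ W : ComVariety, W.Comb → (∀ N, N.Nil → N ≤ W → N ≤ powVar n 0) →
      W ≤ combVar (n + 1) := fun W hW h =>
    le_combVar (powCon_of_forall_nil hW fun N hN hNW => le_powVar_zero_iff.1 (h N hN hNW))
  have hC := combVar_powCon n.succ_ne_zero
  have hnil : ∀ N, N.Nil → N ≤ combVar (n + 1) → N ≤ powVar n 0 := fun N hN hle => by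
    have h1 := powCon_of_le hle hC
    refine le_powVar_zero_iff.2 (hN.isZero_of_r_add (t := {0}) ?_ (by simp))
    rw [← succ_nsmul]
    exact h1
  constructor
  · rintro rfl
    exact ⟨⟨⟨_, hC⟩, hnil⟩, hle⟩
  · rintro ⟨⟨h1, h2⟩, h3⟩
    exact (hle V h1 h2).antisymm (h3 _ ⟨_, hC⟩ hnil)

theorem isPredDef_combVar (m : ℕ) : IsPredDef (· = combVar m) := by
  match m with
  | 0 => rw [combVar_zero]; exact isPredDef_eq_bot
  | 1 => exact isPredDef_combVar_one
  | n + 2 =>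
    refine IsPredDef.congr (fun l t ht => ?_) fun _ => eq_combVar_iff.symm
    have key {l : ℕ} {t : (Fin l → ComVariety) → ComVariety} (ht : IsLatTerm l t) :
        IsLatDef l fun v => ∀ N, N.Nil → N ≤ t v → N ≤ powVar (n + 1) 0 := by
      have : IsLatDef l fun v => ∃ D, D = powVar (n + 1) 0 ∧ ∀ N, N.Nil → N ≤ t v → N ≤ D :=
        .ex (.and (isPredDef_powVar_zero (by omega) _ _ (.last _)) (.all (.imp
          (isPredDef_nil _ _ (.last _)) (.imp (.le (.last _) ht.init.init)
            (.le (.last _) (.init (.last _)))))))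
      exact this.congr fun v => by simp
    exact .and (.and (isPredDef_comb _ _ ht) (key ht)) (.all (.imp (isPredDef_comb _ _ (.last _))
      (.imp (key (.last _)) (.le (.last _) ht.init))))

end ComVariety

/-! ### The variety generated by a commutative monoid -/

namespace ComVariety

theorem lift_eq_prod {M : Type} [CommMonoid M] (f : ℕ → M) (w : SGWord) :
    FreeSemigroup.lift f w = ((letters w).map f).prod := by
  induction w using FreeSemigroup.recOnMul with
  | ih1 i => simp [letters_of]
  | ih2 i w h1 h2 => rw [map_mul, h1, h2, letters_mul, Multiset.map_add, Multiset.prod_add]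

/-- The exponents `a`, `b` for which a monoid satisfies `xᵃ = xᵇ`. -/
def expCon (M : Type) [CommMonoid M] : AddCon ℕ where
  r a b := ∀ x : M, x ^ a = x ^ b
  iseqv := ⟨fun _ _ => rfl, fun h x => (h x).symm, fun h h' x => (h x).trans (h' x)⟩
  add' h h' x := by rw [pow_add, pow_add, h x, h' x]

theorem eq_of_generatedBy {M : Type} [CommMonoid M] {K : ComVariety}
    (hK : GeneratedBy M inferInstance K) : K = (FIC.ofCounts (expCon M)).toVariety := by
  refine le_antisymm (hK.2 ?_) (le_iff.2 fun s t hst => ?_)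
  · rintro ⟨u, v⟩ hi f
    have h := ((FIC.toVariety_r _).1 ((r_letters _ u v).2 hi)).2
    refine (lift_eq_prod f u).trans (Eq.trans ?_ (lift_eq_prod f v).symm)
    have key (w : SGWord) (F : Finset ℕ) (hF : (letters w).toFinset ⊆ F) :
        ((letters w).map f).prod = ∏ i ∈ F, f i ^ (letters w).count i := by
      rw [Finset.prod_multiset_map_count]
      exact Finset.prod_subset hF fun i _ hi => by
        rw [Multiset.count_eq_zero_of_notMem (by simpa using hi), pow_zero]
    rw [key u _ Finset.subset_union_left, key v _ Finset.subset_union_right]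
    exact Finset.prod_congr rfl fun i _ => h i (f i)
  · refine (FIC.toVariety_r _).2 ⟨hst.1, fun i x => ?_⟩
    by_cases hs : s = 0
    · rw [hs, hst.1.1 hs]
    obtain ⟨u, rfl⟩ := exists_letters hs
    obtain ⟨v, rfl⟩ := exists_letters (mt hst.1.2 hs)
    have h := hK.1 _ ((r_letters _ u v).1 hst) fun j => if j = i then x else 1
    have key (w : SGWord) : FreeSemigroup.lift (fun j => if j = i then x else 1) w =
        x ^ (letters w).count i := by
      rw [lift_eq_prod]
      generalize letters w = s
      induction s using Multiset.induction_on with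
      | empty => simp
      | cons a s ih =>
        rw [Multiset.map_cons, Multiset.prod_cons, ih, Multiset.count_cons]
        by_cases ha : i = a
        · simp [ha, pow_succ']
        · simp [ha, Ne.symm ha]
    exact (key u).symm.trans (h.trans (key v))

theorem ofCounts_toVariety_eq (c : AddCon ℕ) : (FIC.ofCounts c).toVariety = ⊤ ∨
    ∃ m n, 1 ≤ n ∧ (FIC.ofCounts c).toVariety = groupVar n ⊔ combVar m := by
  classical
  by_cases hc : ∃ m n, 1 ≤ n ∧ c m (m + n)
  · refine .inr ⟨Nat.find hc, Nat.find (Nat.find_spec hc), (Nat.find_spec (Nat.find_spec hc)).1, ?_⟩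
    have hm : ∀ j, j < Nat.find hc → ∀ n, 1 ≤ n → ¬ c j (j + n) := fun j hj n hn h =>
      Nat.find_min hc hj ⟨n, hn, h⟩
    have hmin : ∀ j, 1 ≤ j → j < Nat.find (Nat.find_spec hc) →
        ¬ c (Nat.find hc) (Nat.find hc + j) :=
      fun j hj hlt h => Nat.find_min (Nat.find_spec hc) hlt ⟨hj, h⟩
    obtain ⟨hn, hmn⟩ := Nat.find_spec (Nat.find_spec hc)
    generalize Nat.find (Nat.find_spec hc) = n at *
    generalize Nat.find hc = m at *
    have key : ∀ a b, c a b ↔ a ≡ b [MOD n] ∧ (a = b ∨ m ≤ a ∧ m ≤ b) := by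
      intro a b
      constructor
      · intro hab
        by_cases hne : a = b
        · exact ⟨hne ▸ Nat.ModEq.refl _, .inl hne⟩
        have hle : ∀ a b, c a b → a < b → m ≤ a := fun a b hab hlt => by
          by_contra! h
          exact hm a h (b - a) (by omega) (by rwa [Nat.add_sub_cancel' hlt.le])
        have hle' : m ≤ a ∧ m ≤ b := by
          rcases Nat.lt_or_gt_of_ne hne with hlt | hlt
          · have := hle a b hab hlt
            omega
          · have := hle b a (c.symm hab) hlt
            omega
        obtain ⟨a, rfl⟩ := Nat.exists_eq_add_of_le hle'.1
        obtain ⟨b, rfl⟩ := Nat.exists_eq_add_of_le hle'.2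
        exact ⟨(modEq_of_addCon hn hmn hmin hab).add_left m, .inr hle'⟩
      · rintro ⟨hab, rfl | ⟨ha, hb⟩⟩
        · exact c.refl _
        · obtain ⟨a, rfl⟩ := Nat.exists_eq_add_of_le ha
          obtain ⟨b, rfl⟩ := Nat.exists_eq_add_of_le hb
          exact addCon_of_modEq hmn (Nat.ModEq.add_left_cancel' m hab)
    have hr : ∀ s t, (FIC.ofCounts c).toVariety.r s t ↔ (groupVar n ⊔ combVar m).r s t := by
      intro s t
      rw [sup_r, groupVar_r, combVar_r, FIC.toVariety_r]
      refine (and_congr_right fun _ => forall_congr' fun i => key _ _).trans ?_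
      rw [forall_and]
      tauto
    exact le_antisymm (le_iff.2 fun s t => (hr s t).2) (le_iff.2 fun s t => (hr s t).1)
  · refine .inl (eq_top_iff.2 fun s t hst => Multiset.ext.2 fun i => ?_)
    have h := ((FIC.toVariety_r _).1 hst).2 i
    push Not at hc
    by_contra hne
    rcases Nat.lt_or_gt_of_ne hne with hlt | hlt
    · exact hc _ (t.count i - s.count i) (by omega) (by rwa [Nat.add_sub_cancel' hlt.le])
    · exact hc _ (s.count i - t.count i) (by omega)
        (by rw [Nat.add_sub_cancel' hlt.le]; exact c.symm h)

end ComVariety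

/-- **Theorem (Definability of a variety generated by a commutative monoid).**
Let `M` be a commutative monoid and let `K` be the semigroup variety generated by `M`
(the smallest semigroup variety containing `M`).  Then `K` is definable in the lattice
**Com** of all commutative semigroup varieties: there is a first-order formula `Φ(x)`
with one free variable in the language of the lattice operations `∨` and `∧` such that
for every commutative semigroup variety `V`, `Φ(V)` is true in **Com** iff `V = K`. -/
theorem definable_variety_generated_by_commutative_monoid
    (M : Type) [CommMonoid M] (K : ComVariety)
    (hK : GeneratedBy M inferInstance K) :
    LatDefinable ComVariety {V : ComVariety | V = K} := by
  refine IsPredDef.latDefinable ?_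
  rw [ComVariety.eq_of_generatedBy hK]
  obtain h | ⟨m, n, hn, h⟩ := ComVariety.ofCounts_toVariety_eq (ComVariety.expCon M)
  · rw [h]
    exact isPredDef_eq_top
  · rw [h]
    exact isPredDef_eq_sup (ComVariety.isPredDef_groupVar hn) (ComVariety.isPredDef_combVar m)
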